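/- For any d-dimensional prismatoid Q with n vertices and width l, with n > 2d and l > d, there exists a (d+1)-dimensional prismatoid with n+1 vertices and width at least l+1, obtained by a one-point suspension at a vertex of a base facet followed by a suitable small perturbation. -/

import Mathlib

noncomputable section

/-- `d`-dimensional Euclidean space. -/
abbrev Esp (d : ℕ) := EuclideanSpace ℝ (Fin d)

/-- The (affine) dimension of a subset of Euclidean space. -/
def polyDim {d : ℕ} (S : Set (Esp d)) : ℕ := Module.finrank ℝ (affineSpan ℝ S).direction

/-- A polytope is a convex hull of finitely many points. -/
def IsPolytope {d : ℕ} (P : Set (Esp d)) : Prop := ∃ S : Finset (Esp d), P = convexHull ℝ ↑S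

/-- A facet of a polytope `P`: a proper nonempty exposed face of dimension one
less than `P`. -/
def IsFacet {d : ℕ} (P F : Set (Esp d)) : Prop :=
  IsExposed ℝ P F ∧ F ≠ P ∧ F.Nonempty ∧ polyDim F + 1 = polyDim P

/-- The dual graph of a polytope: vertices are the facets, two facets being
adjacent when their intersection is a ridge (a face of codimension 2). -/
def dualGraph {d : ℕ} (P : Set (Esp d)) : SimpleGraph {F : Set (Esp d) // IsFacet P F} :=
  SimpleGraph.fromRel (fun F G => polyDim ((F : Set (Esp d)) ∩ (G : Set (Esp d))) + 2 = polyDim P)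

/-- A `d`-prismatoid: a `d`-dimensional polytope with two distinct parallel
facets `Qp`, `Qm` (the bases) containing all of its vertices (extreme points). -/
structure Prismatoid (d : ℕ) where
  P : Set (Esp d)
  Qp : Set (Esp d)
  Qm : Set (Esp d)
  poly : IsPolytope P
  dimP : polyDim P = d
  facetP : IsFacet P Qp
  facetM : IsFacet P Qm
  ne : Qp ≠ Qm
  parallel : (affineSpan ℝ Qp).direction = (affineSpan ℝ Qm).direction
  cover : Set.extremePoints ℝ P ⊆ Qp ∪ Qm

/-- Number of vertices of a prismatoid. -/
def Prismatoid.nverts {d : ℕ} (Q : Prismatoid d) : ℕ := (Set.extremePoints ℝ Q.P).ncard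

/-- The width of a prismatoid: the distance between the two bases in the dual
graph of the polytope. -/
def Prismatoid.width {d : ℕ} (Q : Prismatoid d) : ℕ :=
  (dualGraph Q.P).dist ⟨Q.Qp, Q.facetP⟩ ⟨Q.Qm, Q.facetM⟩

section

open Filter Topology

theorem polyDim_eq_finrank_vectorSpan {d : ℕ} (S : Set (Esp d)) :
    polyDim S = Module.finrank ℝ (vectorSpan ℝ S) := by
  rw [polyDim, direction_affineSpan]

theorem polyDim_mono {d : ℕ} {S T : Set (Esp d)} (h : S ⊆ T) : polyDim S ≤ polyDim T := by
  simp only [polyDim_eq_finrank_vectorSpan]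
  exact Submodule.finrank_mono (vectorSpan_mono ℝ h)

theorem polyDim_convexHull {d : ℕ} (S : Set (Esp d)) : polyDim (convexHull ℝ S) = polyDim S := by
  rw [polyDim, affineSpan_convexHull, polyDim]

theorem polyDim_empty {d : ℕ} : polyDim (∅ : Set (Esp d)) = 0 := by
  simp [polyDim_eq_finrank_vectorSpan]

theorem polyDim_singleton {d : ℕ} (x : Esp d) : polyDim ({x} : Set (Esp d)) = 0 := by
  simp [polyDim_eq_finrank_vectorSpan]

theorem polyDim_insert_le {d : ℕ} (x : Esp d) (S : Set (Esp d)) :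
    polyDim (insert x S) ≤ polyDim S + 1 := by
  simp only [polyDim_eq_finrank_vectorSpan]
  exact finrank_vectorSpan_insert_le_set ℝ S x

theorem polyDim_lt_polyDim_insert {d : ℕ} {x : Esp d} {S : Set (Esp d)} (hS : S.Nonempty)
    (hx : x ∉ affineSpan ℝ S) : polyDim S < polyDim (insert x S) := by
  obtain ⟨s, hs⟩ := hS
  simp only [polyDim_eq_finrank_vectorSpan]
  refine Submodule.finrank_lt_finrank_of_lt
    ((vectorSpan_mono ℝ (Set.subset_insert x S)).lt_of_ne fun h => hx ?_)
  have h1 : x -ᵥ s ∈ vectorSpan ℝ S := by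
    rw [h]
    exact vsub_mem_vectorSpan ℝ (Set.mem_insert _ _) (Set.mem_insert_of_mem _ hs)
  rw [← direction_affineSpan] at h1
  simpa using AffineSubspace.vadd_mem_of_mem_direction h1 (mem_affineSpan ℝ hs)

theorem vectorSpan_le_ker {d : ℕ} {S : Set (Esp d)} {y : StrongDual ℝ (Esp d)} {h : ℝ}
    (hy : ∀ x ∈ S, y x = h) : vectorSpan ℝ S ≤ LinearMap.ker (y : Esp d →ₗ[ℝ] ℝ) := by
  rw [vectorSpan_def, Submodule.span_le]
  rintro _ ⟨a, ha, b, hb, rfl⟩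
  simp [hy a ha, hy b hb]

theorem eq_of_mem_affineSpan {d : ℕ} {S : Set (Esp d)} {y : StrongDual ℝ (Esp d)} {h : ℝ}
    (hy : ∀ x ∈ S, y x = h) {x : Esp d} (hx : x ∈ affineSpan ℝ S) : y x = h := by
  obtain ⟨s, hs⟩ := (affineSpan_nonempty (k := ℝ) (s := S)).1 ⟨x, hx⟩
  have h1 : x -ᵥ s ∈ vectorSpan ℝ S := by
    rw [← direction_affineSpan]
    exact AffineSubspace.vsub_mem_direction hx (mem_affineSpan ℝ hs)
  have h2 := vectorSpan_le_ker hy h1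
  simp only [vsub_eq_sub, LinearMap.mem_ker, ContinuousLinearMap.coe_coe, map_sub] at h2
  linarith [hy s hs]

theorem polyDim_add_one_le_of_const {d : ℕ} {S : Set (Esp d)} {y : StrongDual ℝ (Esp d)} {h : ℝ}
    (hy0 : y ≠ 0) (hy : ∀ x ∈ S, y x = h) : polyDim S + 1 ≤ d := by
  have h1 := Submodule.finrank_mono (vectorSpan_le_ker hy)
  rw [← polyDim_eq_finrank_vectorSpan] at h1
  have h2 : (LinearMap.ker (y : Esp d →ₗ[ℝ] ℝ)) ≠ ⊤ := by
    rw [Ne, LinearMap.ker_eq_top]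
    exact fun h => hy0 (ContinuousLinearMap.coe_injective h)
  have h3 := Submodule.finrank_lt h2
  rw [finrank_euclideanSpace_fin] at h3
  omega

theorem mem_dualAnnihilator_of_const {d : ℕ} {S : Set (Esp d)} {y : StrongDual ℝ (Esp d)} {h : ℝ}
    (hy : ∀ x ∈ S, y x = h) :
    (y : Esp d →ₗ[ℝ] ℝ) ∈ (vectorSpan ℝ S).dualAnnihilator := by
  rw [Submodule.mem_dualAnnihilator]
  exact fun w hw => vectorSpan_le_ker hy hw

theorem exists_smul_eq_of_const {d : ℕ} {S : Set (Esp d)} {y y' : StrongDual ℝ (Esp d)} {h h' : ℝ}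
    (hS : d ≤ polyDim S + 1) (hy0 : y ≠ 0) (hy : ∀ x ∈ S, y x = h) (hy' : ∀ x ∈ S, y' x = h') :
    ∃ c : ℝ, y' = c • y := by
  have h1 := Subspace.finrank_add_finrank_dualAnnihilator_eq (vectorSpan ℝ S)
  rw [← polyDim_eq_finrank_vectorSpan, finrank_euclideanSpace_fin] at h1
  have h2 : Module.finrank ℝ (vectorSpan ℝ S).dualAnnihilator = 1 := by
    have := polyDim_add_one_le_of_const hy0 hy
    omega
  obtain ⟨c, hc⟩ := exists_smul_eq_of_finrank_eq_one h2
    (x := ⟨_, mem_dualAnnihilator_of_const hy⟩)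
    (fun h => hy0 (ContinuousLinearMap.coe_injective (Subtype.ext_iff.1 h)))
    ⟨_, mem_dualAnnihilator_of_const hy'⟩
  refine ⟨c, ContinuousLinearMap.coe_injective ?_⟩
  simpa using (Subtype.ext_iff.1 hc).symm

theorem const_of_mem_dualAnnihilator {d : ℕ} {S : Set (Esp d)} {f : Module.Dual ℝ (Esp d)}
    (hf : f ∈ (vectorSpan ℝ S).dualAnnihilator) : ∃ h, ∀ x ∈ S, f x = h := by
  rcases S.eq_empty_or_nonempty with rfl | ⟨s, hs⟩
  · exact ⟨0, by simp⟩
  · refine ⟨f s, fun x hx => ?_⟩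
    have := (Submodule.mem_dualAnnihilator f).1 hf _ (vsub_mem_vectorSpan ℝ hx hs)
    rw [vsub_eq_sub, map_sub] at this
    linarith

theorem le_polyDim_add_one_of_forall_const {d : ℕ} {S : Set (Esp d)} (l : StrongDual ℝ (Esp d))
    (H : ∀ (y : StrongDual ℝ (Esp d)) (h : ℝ), (∀ x ∈ S, y x = h) → ∃ c : ℝ, y = c • l) :
    d ≤ polyDim S + 1 := by
  have h1 := Subspace.finrank_add_finrank_dualAnnihilator_eq (vectorSpan ℝ S)
  rw [← polyDim_eq_finrank_vectorSpan, finrank_euclideanSpace_fin] at h1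
  have h2 : (vectorSpan ℝ S).dualAnnihilator ≤ Submodule.span ℝ {(l : Esp d →ₗ[ℝ] ℝ)} := by
    intro f hf
    obtain ⟨h, hh⟩ := const_of_mem_dualAnnihilator hf
    obtain ⟨c, hc⟩ := H (LinearMap.toContinuousLinearMap f) h hh
    rw [Submodule.mem_span_singleton]
    refine ⟨c, LinearMap.ext fun x => ?_⟩
    have := DFunLike.congr_fun hc x
    simpa using this.symm
  have h3 := Submodule.finrank_mono h2
  have h4 : Module.finrank ℝ (vectorSpan ℝ S).dualAnnihilator ≤ 1 :=
    h3.trans ((finrank_span_le_card _).trans_eq (by simp))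
  omega

theorem affineSpan_eq_top_of_forall_const {d : ℕ} {S : Set (Esp d)} (hS : S.Nonempty)
    (H : ∀ (y : StrongDual ℝ (Esp d)) (h : ℝ), (∀ x ∈ S, y x = h) → y = 0) :
    affineSpan ℝ S = ⊤ := by
  rw [← AffineSubspace.direction_eq_top_iff_of_nonempty ((affineSpan_nonempty (k := ℝ) (s := S)).2 hS),
    direction_affineSpan]
  have h1 := Subspace.finrank_add_finrank_dualAnnihilator_eq (vectorSpan ℝ S)
  have h2 : (vectorSpan ℝ S).dualAnnihilator = ⊥ := by
    rw [eq_bot_iff]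
    intro f hf
    obtain ⟨h, hh⟩ := const_of_mem_dualAnnihilator hf
    have := H (LinearMap.toContinuousLinearMap f) h hh
    simpa using this
  rw [h2, finrank_bot, add_zero] at h1
  exact Submodule.eq_top_of_finrank_eq h1

theorem eq_zero_of_affineSpan_eq_top {d : ℕ} {S : Set (Esp d)} (hS : affineSpan ℝ S = ⊤)
    {y : StrongDual ℝ (Esp d)} {h : ℝ} (hy : ∀ x ∈ S, y x = h) : y = 0 := by
  ext x
  have h0 := eq_of_mem_affineSpan hy (x := 0) (by rw [hS]; trivial)
  have hx := eq_of_mem_affineSpan hy (x := x) (by rw [hS]; trivial)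
  simp at h0
  simp [hx, h0]

theorem polyDim_eq_of_affineSpan_eq_top {d : ℕ} {S : Set (Esp d)} (hS : affineSpan ℝ S = ⊤) :
    polyDim S = d := by
  rw [polyDim, hS, AffineSubspace.direction_top, finrank_top, finrank_euclideanSpace_fin]

theorem affineSpan_eq_top_of_polyDim_eq {d : ℕ} {S : Set (Esp d)} (hne : S.Nonempty)
    (hS : polyDim S = d) : affineSpan ℝ S = ⊤ := by
  rw [← AffineSubspace.direction_eq_top_iff_of_nonempty ((affineSpan_nonempty (k := ℝ) (s := S)).2 hne)]
  apply Submodule.eq_top_of_finrank_eq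
  rwa [finrank_euclideanSpace_fin]

theorem le_of_mem_convexHull {d : ℕ} {S : Set (Esp d)} {y : StrongDual ℝ (Esp d)} {h : ℝ}
    (hy : ∀ x ∈ S, y x ≤ h) {x : Esp d} (hx : x ∈ convexHull ℝ S) : y x ≤ h :=
  convexHull_min (t := {x | y x ≤ h}) hy (convex_halfSpace_le y.isLinear h) hx

theorem eq_of_mem_convexHull {d : ℕ} {S : Set (Esp d)} {y : StrongDual ℝ (Esp d)} {h : ℝ}
    (hy : ∀ x ∈ S, y x = h) {x : Esp d} (hx : x ∈ convexHull ℝ S) : y x = h :=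
  eq_of_mem_affineSpan hy (convexHull_subset_affineSpan S hx)

theorem mem_convexHull_contact {d : ℕ} {ι : Type*} {p : ι → Esp d} {y : StrongDual ℝ (Esp d)}
    {h : ℝ} (hle : ∀ i, y (p i) ≤ h) {x : Esp d} (hx : x ∈ convexHull ℝ (Set.range p)) :
    x ∈ convexHull ℝ (p '' {i | y (p i) = h}) ↔ y x = h := by
  set C := convexHull ℝ (p '' {i | y (p i) = h}) with hC
  have hCh : ∀ x ∈ C, y x = h := fun x hx => eq_of_mem_convexHull (by simp) hx
  refine ⟨hCh x, fun hxh => ?_⟩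
  have key : x ∈ {x | y x < h ∨ x ∈ C} := by
    refine convexHull_min ?_ ?_ hx
    · rintro _ ⟨i, rfl⟩
      rcases (hle i).lt_or_eq with hi | hi
      · exact Or.inl hi
      · exact Or.inr (subset_convexHull _ _ ⟨i, hi, rfl⟩)
    · intro u hu w hw a b ha hb hab
      by_cases hboth : u ∈ C ∧ w ∈ C
      · exact Or.inr (convex_convexHull _ _ hboth.1 hboth.2 ha hb hab)
      rcases ha.eq_or_lt with rfl | ha
      · rw [zero_add] at hab
        simpa [hab] using hw
      rcases hb.eq_or_lt with rfl | hb
      · rw [add_zero] at hab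
        simpa [hab] using hu
      left
      have hu' : y u ≤ h := hu.elim le_of_lt fun h' => (hCh u h').le
      have hw' : y w ≤ h := hw.elim le_of_lt fun h' => (hCh w h').le
      have hlt : y u < h ∨ y w < h := by
        by_contra! hcon
        exact hboth ⟨hu.resolve_left hcon.1.not_gt, hw.resolve_left hcon.2.not_gt⟩
      have hh : h = a * h + b * h := by rw [← add_mul, hab, one_mul]
      simp only [map_add, map_smul, smul_eq_mul]
      rw [hh]
      rcases hlt with hlt | hlt
      · exact add_lt_add_of_lt_of_le (mul_lt_mul_of_pos_left hlt ha)
          (mul_le_mul_of_nonneg_left hw' hb.le)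
      · exact add_lt_add_of_le_of_lt (mul_le_mul_of_nonneg_left hu' ha.le)
          (mul_lt_mul_of_pos_left hlt hb)
  exact key.resolve_left (by rw [hxh]; exact lt_irrefl h)

theorem contact_subset {d : ℕ} {ι : Type*} (p : ι → Esp d) (I : Set ι) :
    convexHull ℝ (p '' I) ⊆ convexHull ℝ (Set.range p) :=
  convexHull_mono (Set.image_subset_range _ _)

theorem nonempty_of_polyDim {d : ℕ} {S : Set (Esp d)} (hd : 2 ≤ d) (hS : d ≤ polyDim S + 1) :
    S.Nonempty := by
  rw [Set.nonempty_iff_ne_empty]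
  rintro rfl
  rw [polyDim_empty] at hS
  omega

theorem isFacet_contact {d : ℕ} {ι : Type*} {p : ι → Esp d}
    (hspan : affineSpan ℝ (Set.range p) = ⊤) (hd : 2 ≤ d) {y : StrongDual ℝ (Esp d)} {h : ℝ}
    (hy0 : y ≠ 0) (hle : ∀ i, y (p i) ≤ h) (hdim : d ≤ polyDim (p '' {i | y (p i) = h}) + 1) :
    IsFacet (convexHull ℝ (Set.range p)) (convexHull ℝ (p '' {i | y (p i) = h})) := by
  obtain ⟨x₀, hx₀⟩ := nonempty_of_polyDim hd hdim
  have hx₀' := subset_convexHull ℝ _ hx₀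
  have hyx₀ := (mem_convexHull_contact hle (contact_subset p _ hx₀')).1 hx₀'
  have hle' : ∀ x ∈ convexHull ℝ (Set.range p), y x ≤ h := fun x hx =>
    le_of_mem_convexHull (by rintro _ ⟨i, rfl⟩; exact hle i) hx
  refine ⟨fun _ => ⟨y, Set.ext fun x => ⟨fun hx => ?_, fun hx => ?_⟩⟩, ?_, ⟨x₀, hx₀'⟩, ?_⟩
  · have hxP := contact_subset p _ hx
    refine ⟨hxP, fun z hz => ?_⟩
    rw [(mem_convexHull_contact hle hxP).1 hx]
    exact hle' z hz
  · rw [mem_convexHull_contact hle hx.1]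
    exact le_antisymm (hle' x hx.1) (hyx₀ ▸ hx.2 x₀ (contact_subset p _ hx₀'))
  · intro heq
    refine hy0 (eq_zero_of_affineSpan_eq_top hspan (h := h) fun x hx => ?_)
    have hxP := subset_convexHull ℝ _ hx
    exact (mem_convexHull_contact hle hxP).1 (heq ▸ hxP)
  · rw [polyDim_convexHull, polyDim_convexHull, polyDim_eq_of_affineSpan_eq_top hspan]
    refine le_antisymm (polyDim_add_one_le_of_const hy0 (h := h) ?_) hdim
    rintro _ ⟨i, hi, rfl⟩
    exact hi

theorem IsFacet.polyDim_add_one {d : ℕ} {ι : Type*} {p : ι → Esp d} {F : Set (Esp d)}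
    (hspan : affineSpan ℝ (Set.range p) = ⊤) (hF : IsFacet (convexHull ℝ (Set.range p)) F) :
    polyDim F + 1 = d := by
  rw [hF.2.2.2, polyDim_convexHull, polyDim_eq_of_affineSpan_eq_top hspan]

/-- A facet is the set where some nonzero functional attains its maximum. -/
theorem IsFacet.exists_functional {d : ℕ} {P F : Set (Esp d)} (hF : IsFacet P F) :
    ∃ (y : StrongDual ℝ (Esp d)) (h : ℝ), y ≠ 0 ∧ (∀ x ∈ P, y x ≤ h) ∧
      ∀ x, x ∈ F ↔ x ∈ P ∧ y x = h := by
  obtain ⟨hexp, hne, ⟨x₀, hx₀⟩, -⟩ := hF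
  obtain ⟨y, hy⟩ := hexp ⟨x₀, hx₀⟩
  have hx₀' := hx₀
  rw [hy] at hx₀'
  refine ⟨y, y x₀, ?_, hx₀'.2, fun x => ?_⟩
  · rintro rfl
    exact hne (by rw [hy]; simp)
  · rw [hy]
    constructor
    · exact fun hx => ⟨hx.1, le_antisymm (hx₀'.2 x hx.1) (hx.2 x₀ hx₀'.1)⟩
    · exact fun hx => ⟨hx.1, fun z hz => hx.2 ▸ hx₀'.2 z hz⟩

theorem IsFacet.exists_contact {d : ℕ} {ι : Type*} {p : ι → Esp d} {F : Set (Esp d)}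
    (hF : IsFacet (convexHull ℝ (Set.range p)) F) :
    ∃ (y : StrongDual ℝ (Esp d)) (h : ℝ), y ≠ 0 ∧ (∀ i, y (p i) ≤ h) ∧
      (∀ i, p i ∈ F ↔ y (p i) = h) ∧ F = convexHull ℝ (p '' {i | p i ∈ F}) := by
  obtain ⟨y, h, hy0, hle, hiff⟩ := hF.exists_functional
  have hmem : ∀ i, p i ∈ convexHull ℝ (Set.range p) := fun i =>
    subset_convexHull _ _ (Set.mem_range_self i)
  have hI : ∀ i, p i ∈ F ↔ y (p i) = h := fun i => by simp [hiff, hmem]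
  refine ⟨y, h, hy0, fun i => hle _ (hmem i), hI, ?_⟩
  ext x
  simp only [hI]
  rw [hiff]
  constructor
  · rintro ⟨hx, hxh⟩
    exact (mem_convexHull_contact (fun i => hle _ (hmem i)) hx).2 hxh
  · intro hx
    have hxP := contact_subset p _ hx
    exact ⟨hxP, (mem_convexHull_contact (fun i => hle _ (hmem i)) hxP).1 hx⟩

theorem IsFacet.inter_eq {d : ℕ} {ι : Type*} {p : ι → Esp d} {F G : Set (Esp d)}
    (hF : IsFacet (convexHull ℝ (Set.range p)) F) (hG : IsFacet (convexHull ℝ (Set.range p)) G) :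
    F ∩ G = convexHull ℝ (p '' {i | p i ∈ F ∧ p i ∈ G}) := by
  obtain ⟨y, h, -, hle, hiff⟩ := hF.exists_functional
  obtain ⟨z, k, -, hle', hiff'⟩ := hG.exists_functional
  have hmem : ∀ i, p i ∈ convexHull ℝ (Set.range p) := fun i =>
    subset_convexHull _ _ (Set.mem_range_self i)
  have hsum : ∀ x ∈ convexHull ℝ (Set.range p), (x ∈ F ∧ x ∈ G) ↔ (y + z) x = h + k := by
    intro x hx
    have h1 := hle x hx
    have h2 := hle' x hx
    simp only [hiff, hiff', hx, true_and, add_apply]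
    constructor
    · rintro ⟨rfl, rfl⟩; rfl
    · intro h3; constructor <;> linarith
  have hset : {i | p i ∈ F ∧ p i ∈ G} = {i | (y + z) (p i) = h + k} := by
    ext i; exact hsum _ (hmem i)
  have hle'' : ∀ i, (y + z) (p i) ≤ h + k := fun i =>
    add_le_add (hle _ (hmem i)) (hle' _ (hmem i))
  rw [hset]
  ext x
  constructor
  · rintro ⟨hx, hx'⟩
    have hxP := ((hiff x).1 hx).1
    exact (mem_convexHull_contact hle'' hxP).2 ((hsum x hxP).1 ⟨hx, hx'⟩)
  · intro hx
    have hxP := contact_subset p _ hx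
    exact (hsum x hxP).2 ((mem_convexHull_contact hle'' hxP).1 hx)

/-- A facet of a full-dimensional polytope is determined by any subset of codimension one. -/
theorem IsFacet.eq_of_subset {d : ℕ} {P F G S : Set (Esp d)} (hP : affineSpan ℝ P = ⊤)
    (hF : IsFacet P F) (hG : IsFacet P G) (hne : S.Nonempty) (hdim : d ≤ polyDim S + 1)
    (hSF : S ⊆ F) (hSG : S ⊆ G) : F = G := by
  obtain ⟨y, h, hy0, hle, hiff⟩ := hF.exists_functional
  obtain ⟨z, k, hz0, hle', hiff'⟩ := hG.exists_functional
  obtain ⟨s, hs⟩ := hne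
  obtain ⟨c, rfl⟩ := exists_smul_eq_of_const hdim hy0 (fun x hx => ((hiff x).1 (hSF hx)).2)
    (fun x hx => ((hiff' x).1 (hSG hx)).2)
  have hc0 : c ≠ 0 := by rintro rfl; simp at hz0
  have hys := ((hiff s).1 (hSF hs)).2
  have hzs := ((hiff' s).1 (hSG hs)).2
  rw [smul_apply, smul_eq_mul, hys] at hzs
  rcases hc0.lt_or_gt with hc | hc
  · exfalso
    refine hy0 (eq_zero_of_affineSpan_eq_top hP (h := h) fun x hx => ?_)
    have h1 := hle x hx
    have h2 := hle' x hx
    rw [smul_apply, smul_eq_mul, ← hzs] at h2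
    exact le_antisymm h1 ((mul_le_mul_left_of_neg hc).1 h2)
  · ext x
    rw [hiff, hiff', smul_apply, smul_eq_mul, ← hzs, mul_right_inj' hc0]

theorem affineSpan_convexHull_range_eq_top {d : ℕ} {ι : Type*} {p : ι → Esp d}
    (hspan : affineSpan ℝ (Set.range p) = ⊤) :
    affineSpan ℝ (convexHull ℝ (Set.range p)) = ⊤ := by
  rw [affineSpan_convexHull, hspan]

theorem exists_isFacet_of_supporting {d : ℕ} {ι : Type*} {p : ι → Esp d}
    (hspan : affineSpan ℝ (Set.range p) = ⊤) (hd : 2 ≤ d) {J : Set ι} {y : StrongDual ℝ (Esp d)}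
    (hy0 : y ≠ 0) (hJ : ∀ j ∈ J, ∀ i, y (p i) ≤ y (p j)) (hdim : d ≤ polyDim (p '' J) + 1) :
    ∃ F, IsFacet (convexHull ℝ (Set.range p)) F ∧ p '' J ⊆ F := by
  obtain ⟨_, j, hj, rfl⟩ := nonempty_of_polyDim hd hdim
  have hsub : p '' J ⊆ p '' {i | y (p i) = y (p j)} :=
    Set.image_mono fun i hi => le_antisymm (hJ j hj i) (hJ i hi j)
  exact ⟨_, isFacet_contact hspan hd hy0 (hJ j hj)
    (hdim.trans (by simpa using polyDim_mono hsub)), hsub.trans (subset_convexHull _ _)⟩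

theorem dualGraph_adj_iff {d : ℕ} {P : Set (Esp d)} {F G : {F : Set (Esp d) // IsFacet P F}} :
    (dualGraph P).Adj F G ↔ F ≠ G ∧ polyDim (F.1 ∩ G.1) + 2 = polyDim P := by
  rw [dualGraph, SimpleGraph.fromRel_adj, Set.inter_comm G.1 F.1, or_self]

theorem dualGraph_adj_of_subset {d : ℕ} {P S : Set (Esp d)} (hd : 2 ≤ d)
    (hP : affineSpan ℝ P = ⊤) {F G : {F : Set (Esp d) // IsFacet P F}} (hFG : F ≠ G)
    (hSF : S ⊆ F.1) (hSG : S ⊆ G.1) (hdim : d ≤ polyDim S + 2) : (dualGraph P).Adj F G := by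
  rw [dualGraph_adj_iff]
  refine ⟨hFG, ?_⟩
  have h1 := polyDim_mono (Set.subset_inter hSF hSG)
  have h2 : ¬ d ≤ polyDim (F.1 ∩ G.1) + 1 := fun h =>
    hFG (Subtype.ext (F.2.eq_of_subset hP G.2 (nonempty_of_polyDim hd h) h
      Set.inter_subset_left Set.inter_subset_right))
  rw [polyDim_eq_of_affineSpan_eq_top hP]
  omega

/-- A nonempty finite family has a point in its convex hull that lies on a supporting hyperplane
only if the whole family does. -/
theorem exists_mem_convexHull_generic {d : ℕ} {ι : Type*} [Finite ι] (p : ι → Esp d) {I : Set ι}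
    (hI : I.Nonempty) : ∃ c ∈ convexHull ℝ (p '' I), ∀ (y : StrongDual ℝ (Esp d)) (h : ℝ),
      (∀ i ∈ I, y (p i) ≤ h) → y c = h → ∀ i ∈ I, y (p i) = h := by
  classical
  have := Fintype.ofFinite ι
  set s := I.toFinset with hs
  have hsI : ∀ i, i ∈ s ↔ i ∈ I := fun i => Set.mem_toFinset
  have hcard : (0 : ℝ) < s.card := by
    obtain ⟨i, hi⟩ := hI
    exact_mod_cast Finset.card_pos.2 ⟨i, (hsI i).2 hi⟩
  refine ⟨∑ i ∈ s, (s.card : ℝ)⁻¹ • p i, ?_, ?_⟩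
  · refine (convex_convexHull ℝ _).sum_mem (fun i _ => by positivity) ?_ fun i hi =>
      subset_convexHull ℝ _ ⟨i, (hsI i).1 hi, rfl⟩
    simp [hcard.ne']
  · intro y h hle heq i hi
    have h1 : ∑ i ∈ s, (h - y (p i)) = 0 := by
      have h2 : ∑ i ∈ s, y (p i) = s.card * h := by
        rw [← heq, map_sum, Finset.mul_sum]
        refine Finset.sum_congr rfl fun i _ => ?_
        rw [map_smul, smul_eq_mul, mul_inv_cancel_left₀ hcard.ne']
      rw [Finset.sum_sub_distrib, h2]
      simp
    have h3 := (Finset.sum_eq_zero_iff_of_nonneg fun j hj =>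
      sub_nonneg.2 (hle j ((hsI j).1 hj))).1 h1 i ((hsI i).2 hi)
    linarith

theorem finite_isFacet {d : ℕ} {ι : Type*} [Finite ι] (p : ι → Esp d) :
    Finite {F : Set (Esp d) // IsFacet (convexHull ℝ (Set.range p)) F} := by
  refine Finite.of_injective (fun F => {i | p i ∈ F.1}) fun F G hFG => Subtype.ext ?_
  obtain ⟨-, -, -, -, -, hF⟩ := F.2.exists_contact
  obtain ⟨-, -, -, -, -, hG⟩ := G.2.exists_contact
  rw [hF, hG]
  exact congrArg (fun I => convexHull ℝ (p '' I)) hFG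

theorem exists_mem_sub_pos {d : ℕ} {P : Set (Esp d)} {c : Esp d} (hc : c ∈ interior P)
    {y : StrongDual ℝ (Esp d)} (hy : y ≠ 0) : ∃ x ∈ P, y c < y x := by
  obtain ⟨w, hw⟩ : ∃ w, 0 < y w := by
    obtain ⟨w, hw⟩ := DFunLike.ne_iff.1 hy
    rcases lt_or_gt_of_ne hw with h | h
    · exact ⟨-w, by simpa using h⟩
    · exact ⟨w, h⟩
  have hcont : Tendsto (fun t : ℝ => c + t • w) (𝓝[>] 0) (𝓝 c) := by
    have : Tendsto (fun t : ℝ => c + t • w) (𝓝 0) (𝓝 (c + (0 : ℝ) • w)) :=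
      (by fun_prop : Continuous fun t : ℝ => c + t • w).tendsto 0
    rw [zero_smul, add_zero] at this
    exact this.mono_left nhdsWithin_le_nhds
  obtain ⟨t, ht, ht0⟩ := ((hcont.eventually (mem_interior_iff_mem_nhds.1 hc)).and
    self_mem_nhdsWithin).exists
  refine ⟨_, ht, ?_⟩
  have : 0 < t * y w := mul_pos ht0 hw
  simpa using this

theorem IsFacet.exists_normalized {d : ℕ} {P F : Set (Esp d)} (hF : IsFacet P F) {c : Esp d}
    (hc : c ∈ interior P) : ∃ y : StrongDual ℝ (Esp d), (∀ x ∈ P, y (x - c) ≤ 1) ∧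
      ∀ x, x ∈ F ↔ x ∈ P ∧ y (x - c) = 1 := by
  obtain ⟨y, h, hy0, hle, hiff⟩ := hF.exists_functional
  obtain ⟨x₀, hx₀, hlt⟩ := exists_mem_sub_pos hc hy0
  have hpos : 0 < h - y c := by linarith [hle x₀ hx₀]
  have hval : ∀ x, ((h - y c)⁻¹ • y) (x - c) = (y x - y c) / (h - y c) := fun x => by
    rw [smul_apply, smul_eq_mul, map_sub]; ring
  refine ⟨(h - y c)⁻¹ • y, fun x hx => ?_, fun x => ?_⟩
  · rw [hval, div_le_one hpos]
    linarith [hle x hx]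
  · rw [hval, div_eq_one_iff_eq hpos.ne', hiff, sub_left_inj]

theorem isCompact_polar {d : ℕ} {ι : Type*} {p : ι → Esp d} {c : Esp d}
    (hc : c ∈ interior (convexHull ℝ (Set.range p))) :
    IsCompact {y : StrongDual ℝ (Esp d) | ∀ i, y (p i - c) ≤ 1} := by
  have := FiniteDimensional.proper ℝ (StrongDual ℝ (Esp d))
  refine Metric.isCompact_of_isClosed_isBounded ?_ ?_
  · simp only [Set.ofPred_forall]
    exact isClosed_iInter fun i => isClosed_le (by fun_prop) continuous_const
  · obtain ⟨r, hr, hball⟩ := Metric.mem_nhds_iff.1 (mem_interior_iff_mem_nhds.1 hc)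
    refine (NormedSpace.isBounded_polar_of_mem_nhds_zero ℝ
      (Metric.ball_mem_nhds (0 : Esp d) hr)).subset fun y hy => ?_
    have key : ∀ z ∈ Metric.ball (0 : Esp d) r, y z ≤ 1 := by
      intro z hz
      have h1 : c + z ∈ convexHull ℝ (Set.range p) := hball (by simpa using hz)
      have h2 := le_of_mem_convexHull (y := y) (h := 1 + y c) (by
        rintro _ ⟨i, rfl⟩
        have := hy i
        rw [map_sub] at this
        linarith) h1
      rw [map_add] at h2
      linarith
    intro z hz
    refine abs_le.2 ⟨?_, key z hz⟩
    have := key (-z) (by simpa using hz)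
    rw [map_neg] at this
    change -1 ≤ y z
    linarith

/-- A full-dimensional polytope is cut out by its facet inequalities. -/
theorem mem_convexHull_of_forall_facet {d : ℕ} {ι : Type*} [Finite ι] {p : ι → Esp d}
    (hspan : affineSpan ℝ (Set.range p) = ⊤) (hd : 2 ≤ d) {c : Esp d}
    (hc : c ∈ interior (convexHull ℝ (Set.range p)))
    (Y : {F : Set (Esp d) // IsFacet (convexHull ℝ (Set.range p)) F} → StrongDual ℝ (Esp d))
    (hY : ∀ F x, x ∈ F.1 ↔ x ∈ convexHull ℝ (Set.range p) ∧ Y F (x - c) = 1)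
    {x : Esp d} (hx : ∀ F, Y F (x - c) ≤ 1) : x ∈ convexHull ℝ (Set.range p) := by
  by_contra hxP
  set K := {y : StrongDual ℝ (Esp d) | ∀ i, y (p i - c) ≤ 1} with hK
  have hKc : IsCompact K := isCompact_polar hc
  obtain ⟨f, u, hfu, hux⟩ := geometric_hahn_banach_closed_point (convex_convexHull ℝ _)
    ((Set.finite_range p).isClosed_convexHull ℝ) hxP
  have hfc : 0 < u - f c := sub_pos.2 (hfu c (interior_subset hc))
  have hgK : (u - f c)⁻¹ • f ∈ K := by
    intro i
    rw [smul_apply, smul_eq_mul, map_sub, inv_mul_le_one₀ hfc]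
    linarith [hfu _ (subset_convexHull ℝ _ (Set.mem_range_self i))]
  have hgx : 1 < ((u - f c)⁻¹ • f) (x - c) := by
    rw [smul_apply, smul_eq_mul, map_sub, one_lt_inv_mul₀ hfc]
    linarith
  obtain ⟨y₁, hy₁K, hy₁⟩ := hKc.exists_isMaxOn ⟨_, hgK⟩
    (f := fun y : StrongDual ℝ (Esp d) => y (x - c)) (by fun_prop)
  set l : StrongDual ℝ (StrongDual ℝ (Esp d)) := ContinuousLinearMap.apply ℝ ℝ (x - c)
  have hexp : IsExposed ℝ K {y ∈ K | ∀ y' ∈ K, l y' ≤ l y} := fun _ => ⟨l, rfl⟩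
  obtain ⟨y, hy⟩ := (hexp.isCompact hKc).extremePoints_nonempty ⟨y₁, hy₁K, fun y' hy' => hy₁ hy'⟩
  have hyx : 1 < y (x - c) := hgx.trans_le (hy.1.2 _ hgK)
  have hyK := hexp.isExtreme.extremePoints_subset_extremePoints hy
  have hle : ∀ i, y (p i) ≤ 1 + y c := fun i => by
    have := hyK.1 i
    rw [map_sub] at this
    linarith
  have hy0 : y ≠ 0 := by
    rintro rfl
    simp at hyx
    linarith
  have hdim : d ≤ polyDim (p '' {i | y (p i) = 1 + y c}) + 1 := by
    refine le_polyDim_add_one_of_forall_const y fun z k hz => ⟨k - z c, ?_⟩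
    set w := z - (k - z c) • y with hw
    have hwC : ∀ i, y (p i) = 1 + y c → w (p i - c) = 0 := by
      intro i hi
      have h1 := hz _ ⟨i, hi, rfl⟩
      rw [hw, sub_apply, smul_apply, smul_eq_mul, map_sub, map_sub, hi, h1]
      ring
    have hev : ∀ᶠ t : ℝ in 𝓝 0, ∀ i, y (p i - c) + t * w (p i - c) ≤ 1 := by
      rw [eventually_all]
      intro i
      by_cases hi : y (p i) = 1 + y c
      · filter_upwards with t
        rw [hwC i hi, mul_zero, add_zero]
        exact hyK.1 i
      · have hlt : y (p i - c) < 1 := by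
          rw [map_sub]
          linarith [lt_of_le_of_ne (hle i) hi]
        have hcont : Tendsto (fun t : ℝ => y (p i - c) + t * w (p i - c)) (𝓝 0)
            (𝓝 (y (p i - c) + 0 * w (p i - c))) :=
          (by fun_prop : Continuous fun t : ℝ => y (p i - c) + t * w (p i - c)).tendsto 0
        rw [zero_mul, add_zero] at hcont
        exact (hcont.eventually (gt_mem_nhds hlt)).mono fun t ht => ht.le
    have hev' : ∀ᶠ t : ℝ in 𝓝 0, ∀ i, y (p i - c) + -t * w (p i - c) ≤ 1 := by
      have : Tendsto (fun t : ℝ => -t) (𝓝 0) (𝓝 0) := by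
        simpa using (continuous_neg (G := ℝ)).tendsto 0
      exact this.eventually hev
    obtain ⟨t, ⟨ht1, ht2⟩, ht0⟩ := (((hev.and hev').filter_mono nhdsWithin_le_nhds).and
      (self_mem_nhdsWithin (s := Set.Ioi (0 : ℝ)))).exists
    have heq := (mem_extremePoints_iff_left.1 hyK).2 (y + t • w)
      (fun i => by simpa using ht1 i) (y + -t • w) (fun i => by simpa using ht2 i)
      ⟨1 / 2, 1 / 2, by norm_num, by norm_num, by norm_num, by module⟩
    have hw0 : w = 0 := by
      have h1 : t • w = 0 := by simpa using heq
      exact (smul_eq_zero.1 h1).resolve_left (ne_of_gt ht0)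
    exact sub_eq_zero.1 hw0
  obtain ⟨_, i, hi, rfl⟩ := nonempty_of_polyDim hd hdim
  set F : {F : Set (Esp d) // IsFacet (convexHull ℝ (Set.range p)) F} :=
    ⟨_, isFacet_contact hspan hd hy0 hle hdim⟩ with hF
  have hYF : ∀ j, y (p j) = 1 + y c → Y F (p j) = 1 + Y F c := by
    intro j hj
    have := ((hY F _).1 (subset_convexHull ℝ _ ⟨j, hj, rfl⟩)).2
    rw [map_sub] at this
    linarith
  obtain ⟨k, hk⟩ := exists_smul_eq_of_const hdim hy0 (y' := Y F) (h := 1 + y c)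
    (h' := 1 + Y F c) (by rintro _ ⟨j, hj, rfl⟩; exact hj)
    (by rintro _ ⟨j, hj, rfl⟩; exact hYF j hj)
  have h1 := hYF i hi
  rw [hk, smul_apply, smul_apply, smul_eq_mul, smul_eq_mul, show y (p i) = 1 + y c from hi] at h1
  have hk1 : k = 1 := by linarith
  have h2 := hx F
  rw [hk, hk1, one_smul] at h2
  linarith

theorem finrank_span_sub_le {d : ℕ} (c : Esp d) (S : Set (Esp d)) :
    Module.finrank ℝ (Submodule.span ℝ ((fun x => x - c) '' S)) ≤ polyDim S + 1 := by
  refine le_trans ?_ (polyDim_insert_le c S)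
  rw [polyDim_eq_finrank_vectorSpan]
  refine Submodule.finrank_mono (Submodule.span_le.2 ?_)
  rintro _ ⟨x, hx, rfl⟩
  exact vsub_mem_vectorSpan ℝ (Set.mem_insert_of_mem c hx) (Set.mem_insert c S)

theorem notMem_of_segment_avoid {d : ℕ} {U W : Set (Esp d)} (hU : IsClosed U) (hW : IsClosed W)
    (hUW : U ∪ W = Set.univ) {κ : Type*} {L : κ → Submodule ℝ (Esp d)}
    (hL : ∀ q, q ∈ U → q ∈ W → ∃ k, q ∈ L k) {x z : Esp d} (hx : x ∉ W)
    (hz : ∀ k, z ∉ L k ⊔ Submodule.span ℝ {x}) : z ∉ W := by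
  intro hzW
  have hxU : x ∈ U := (hUW.ge (Set.mem_univ x)).resolve_right hx
  obtain ⟨q, hq, hqU, hqW⟩ := isPreconnected_closed_iff.1 (convex_segment x z).isPreconnected U W
    hU hW (hUW ▸ Set.subset_univ _) ⟨x, left_mem_segment ℝ x z, hxU⟩
    ⟨z, right_mem_segment ℝ x z, hzW⟩
  obtain ⟨k, hk⟩ := hL q hqU hqW
  obtain ⟨a, b, -, -, hab, rfl⟩ := hq
  rcases eq_or_ne b 0 with rfl | hb
  · obtain rfl : a = 1 := by linarith
    exact hx (by simpa using hqW)
  · refine hz k ?_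
    have h1 : z = b⁻¹ • ((a • x + b • z) - a • x) := by
      rw [add_sub_cancel_left, smul_smul, inv_mul_cancel₀ hb, one_smul]
    rw [h1]
    exact Submodule.smul_mem _ _ (Submodule.sub_mem _ (Submodule.mem_sup_left hk)
      (Submodule.smul_mem _ _ (Submodule.mem_sup_right (Submodule.mem_span_singleton_self x))))

theorem exists_notMem_sup_span {d : ℕ} {κ : Type*} [Finite κ] {L : κ → Submodule ℝ (Esp d)}
    (hL : ∀ k, Module.finrank ℝ (L k) + 2 ≤ d) (x y : Esp d) :
    ∃ z, (∀ k, z ∉ L k ⊔ Submodule.span ℝ {x}) ∧ ∀ k, z ∉ L k ⊔ Submodule.span ℝ {y} := by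
  by_contra! H
  have hU : ⋃ k : κ × Bool, ((L k.1 ⊔ Submodule.span ℝ {if k.2 then x else y} :
      Submodule ℝ (Esp d)) : Set (Esp d)) = Set.univ := by
    refine Set.eq_univ_of_forall fun z => Set.mem_iUnion.2 ?_
    by_cases hz : ∀ k, z ∉ L k ⊔ Submodule.span ℝ {x}
    · obtain ⟨k, hk⟩ := H z hz
      exact ⟨(k, false), by simpa using hk⟩
    · push Not at hz
      obtain ⟨k, hk⟩ := hz
      exact ⟨(k, true), by simpa using hk⟩
  obtain ⟨⟨k, b⟩, hk⟩ := Subspace.exists_eq_top_of_iUnion_eq_univ hU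
  have h1 := Submodule.finrank_add_le_finrank_add_finrank (L k)
    (Submodule.span ℝ {if b then x else y})
  have h2 : Module.finrank ℝ (Submodule.span ℝ {if b then x else y}) ≤ 1 := by
    simpa using finrank_span_le_card (R := ℝ) ({if b then x else y} : Set (Esp d))
  have h3 := hL k
  simp only at hk
  rw [hk, finrank_top, finrank_euclideanSpace_fin] at h1
  omega

theorem exists_facet_dominant {d : ℕ} {ι : Type*} [Finite ι] {p : ι → Esp d}
    (hspan : affineSpan ℝ (Set.range p) = ⊤) (hd : 2 ≤ d) {c : Esp d}
    {Y : {F : Set (Esp d) // IsFacet (convexHull ℝ (Set.range p)) F} → StrongDual ℝ (Esp d)}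
    (hYle : ∀ F, ∀ x ∈ convexHull ℝ (Set.range p), Y F (x - c) ≤ 1)
    (hY : ∀ F x, x ∈ F.1 ↔ x ∈ convexHull ℝ (Set.range p) ∧ Y F (x - c) = 1)
    (F : {F : Set (Esp d) // IsFacet (convexHull ℝ (Set.range p)) F}) :
    ∃ q, ∀ H, H ≠ F → Y H q < Y F q := by
  have hdim := F.2.polyDim_add_one hspan
  obtain ⟨-, -, -, -, -, hF⟩ := F.2.exists_contact
  have hdimI : d ≤ polyDim (p '' {i | p i ∈ F.1}) + 1 := by
    rw [← polyDim_convexHull, ← hF, hdim]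
  have hne := nonempty_of_polyDim hd hdimI
  have hmem : ∀ i, p i ∈ convexHull ℝ (Set.range p) := fun i =>
    subset_convexHull _ _ (Set.mem_range_self i)
  obtain ⟨g, hg, hgen⟩ := exists_mem_convexHull_generic p (I := {i | p i ∈ F.1})
    (by simpa using hne)
  rw [← hF] at hg
  have hg' := (hY F g).1 hg
  refine ⟨g - c, fun H hHF => ?_⟩
  rw [hg'.2]
  refine (hYle H g hg'.1).lt_of_ne fun h1 => hHF (Subtype.ext ?_)
  refine H.2.eq_of_subset (affineSpan_convexHull_range_eq_top hspan) F.2 hne hdimI ?_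
    (Set.image_subset_iff.2 fun i hi => hi)
  have := hgen (Y H) (1 + Y H c) (fun i _ => by
    have := hYle H _ (hmem i)
    rw [map_sub] at this
    linarith)
    (by rw [map_sub] at h1; linarith)
  rintro _ ⟨i, hi, rfl⟩
  exact (hY H _).2 ⟨hmem i, by rw [map_sub, this i hi]; ring⟩

/-- The dual graph of a full-dimensional polytope is connected. -/
theorem dualGraph_reachable {d : ℕ} {ι : Type*} [Finite ι] {p : ι → Esp d}
    (hspan : affineSpan ℝ (Set.range p) = ⊤) (hd : 2 ≤ d)
    (F₀ G₀ : {F : Set (Esp d) // IsFacet (convexHull ℝ (Set.range p)) F}) :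
    (dualGraph (convexHull ℝ (Set.range p))).Reachable F₀ G₀ := by
  by_contra hFG
  have := finite_isFacet p
  have hne : Nonempty {F : Set (Esp d) // IsFacet (convexHull ℝ (Set.range p)) F} := ⟨F₀⟩
  obtain ⟨c, hc⟩ := interior_convexHull_nonempty_iff_affineSpan_eq_top.2 hspan
  choose Y hYle hY using fun F : {F : Set (Esp d) // IsFacet (convexHull ℝ (Set.range p)) F} =>
    F.2.exists_normalized hc
  let R := (dualGraph (convexHull ℝ (Set.range p))).Reachable F₀
  let V : ({F : Set (Esp d) // IsFacet (convexHull ℝ (Set.range p)) F} → Prop) → Set (Esp d) :=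
    fun A => {z | ∃ F, A F ∧ ∀ G, Y G z ≤ Y F z}
  have hclosed : ∀ A, IsClosed (V A) := by
    intro A
    have : V A = ⋃ F : {F // A F}, ⋂ G, {z | Y G z ≤ Y F.1 z} := by
      ext z; simp [V]
    rw [this]
    exact isClosed_iUnion_of_finite fun F => isClosed_iInter fun G =>
      isClosed_le (Y G).continuous (Y F.1).continuous
  have hcover : V R ∪ V (fun F => ¬ R F) = Set.univ := by
    refine Set.eq_univ_of_forall fun z => ?_
    obtain ⟨F, hF⟩ := Finite.exists_max fun F => Y F z
    by_cases hRF : R F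
    · exact Or.inl ⟨F, hRF, hF⟩
    · exact Or.inr ⟨F, hRF, hF⟩
  let κ := {k : {F : Set (Esp d) // IsFacet (convexHull ℝ (Set.range p)) F} ×
    {F : Set (Esp d) // IsFacet (convexHull ℝ (Set.range p)) F} // R k.1 ∧ ¬ R k.2}
  let L : κ → Submodule ℝ (Esp d) := fun k =>
    Submodule.span ℝ ((fun x => x - c) '' (k.1.1.1 ∩ k.1.2.1))
  have hLdim : ∀ k, Module.finrank ℝ (L k) + 2 ≤ d := by
    rintro ⟨⟨F, G⟩, hF, hG⟩
    have h1 := finrank_span_sub_le c (F.1 ∩ G.1)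
    have h2 : ¬ d ≤ polyDim (F.1 ∩ G.1) + 2 := fun h => hG (hF.trans
      (dualGraph_adj_of_subset hd (affineSpan_convexHull_range_eq_top hspan)
        (by rintro rfl; exact hG hF) Set.inter_subset_left Set.inter_subset_right h).reachable)
    simp only [L]
    omega
  have hL : ∀ q, q ∈ V R → q ∈ V (fun F => ¬ R F) → ∃ k, q ∈ L k := by
    rintro q ⟨F, hRF, hF⟩ ⟨G, hRG, hG⟩
    refine ⟨⟨(F, G), hRF, hRG⟩, ?_⟩
    rcases eq_or_ne q 0 with rfl | hq0
    · exact Submodule.zero_mem _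
    have hGF : Y G q = Y F q := le_antisymm (hF G) (hG F)
    have hpos : 0 < Y F q := by
      by_contra! hneg
      have hray : ∀ t : ℝ, 0 ≤ t → c + t • q ∈ convexHull ℝ (Set.range p) := fun t ht => by
        refine mem_convexHull_of_forall_facet hspan hd hc Y hY fun H => ?_
        rw [add_sub_cancel_left, map_smul, smul_eq_mul]
        nlinarith [hF H]
      obtain ⟨r, hr⟩ := ((isBounded_convexHull).2
        (Set.finite_range p).isBounded).subset_closedBall c
      have h1 := hr (hray ((|r| + 1) / ‖q‖) (by positivity))
      have h2 : ‖q‖ ≠ 0 := norm_ne_zero_iff.2 hq0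
      rw [Metric.mem_closedBall, dist_eq_norm, add_sub_cancel_left, norm_smul, Real.norm_eq_abs,
        abs_of_nonneg (by positivity), div_mul_cancel₀ _ h2] at h1
      linarith [le_abs_self r]
    have hval : ∀ H, Y H ((c + (Y F q)⁻¹ • q) - c) = (Y F q)⁻¹ * Y H q := fun H => by
      rw [add_sub_cancel_left, map_smul, smul_eq_mul]
    have hmem : c + (Y F q)⁻¹ • q ∈ convexHull ℝ (Set.range p) := by
      refine mem_convexHull_of_forall_facet hspan hd hc Y hY fun H => ?_
      rw [hval, inv_mul_le_iff₀ hpos, mul_one]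
      exact hF H
    have hq : q = Y F q • ((c + (Y F q)⁻¹ • q) - c) := by
      rw [add_sub_cancel_left, smul_smul, mul_inv_cancel₀ hpos.ne', one_smul]
    rw [hq]
    refine Submodule.smul_mem _ _ (Submodule.subset_span ⟨_, ⟨?_, ?_⟩, rfl⟩)
    · exact (hY F _).2 ⟨hmem, by rw [hval, inv_mul_cancel₀ hpos.ne']⟩
    · exact (hY G _).2 ⟨hmem, by rw [hval, hGF, inv_mul_cancel₀ hpos.ne']⟩
  obtain ⟨x, hx⟩ := exists_facet_dominant hspan hd hYle hY F₀
  obtain ⟨y, hy⟩ := exists_facet_dominant hspan hd hYle hY G₀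
  have hxW : x ∉ V (fun F => ¬ R F) := by
    rintro ⟨F, hF, hmax⟩
    exact (hx F (by rintro rfl; exact hF (SimpleGraph.Reachable.refl _))).not_ge (hmax F₀)
  have hyU : y ∉ V R := by
    rintro ⟨F, hF, hmax⟩
    exact (hy F (by rintro rfl; exact hFG hF)).not_ge (hmax G₀)
  obtain ⟨z, hzx, hzy⟩ := exists_notMem_sup_span hLdim x y
  rcases hcover.ge (Set.mem_univ z) with hz | hz
  · exact notMem_of_segment_avoid (hclosed _) (hclosed _) ((Set.union_comm _ _).trans hcover)
      (fun q h1 h2 => hL q h2 h1) hyU hzy hz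
  · exact notMem_of_segment_avoid (hclosed _) (hclosed _) hcover hL hxW hzx hz

theorem eventually_forall_supporting {d : ℕ} {ι : Type*} [Finite ι] {q : ℝ → ι → Esp d}
    (hq : ∀ i, Continuous fun t => q t i) :
    ∀ᶠ t in 𝓝 (0 : ℝ), ∀ S : Set ι,
      (∃ y : StrongDual ℝ (Esp d), y ≠ 0 ∧ ∀ j ∈ S, ∀ i, y (q t i) ≤ y (q t j)) →
      ∃ y : StrongDual ℝ (Esp d), y ≠ 0 ∧ ∀ j ∈ S, ∀ i, y (q 0 i) ≤ y (q 0 j) := by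
  rw [eventually_all]
  intro S
  have := FiniteDimensional.proper ℝ (StrongDual ℝ (Esp d))
  let C : Set (Metric.sphere (0 : StrongDual ℝ (Esp d)) 1 × ℝ) :=
    {x | ∀ j ∈ S, ∀ i, x.1.1 (q x.2 i) ≤ x.1.1 (q x.2 j)}
  have hC : IsClosed C := by
    simp only [C, Set.ofPred_forall]
    refine isClosed_iInter fun j => isClosed_iInter fun _ => isClosed_iInter fun i => ?_
    have hval : ∀ i, Continuous fun x : Metric.sphere (0 : StrongDual ℝ (Esp d)) 1 × ℝ =>
        x.1.1 (q x.2 i) := fun i =>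
      (continuous_subtype_val.comp continuous_fst).clm_apply ((hq i).comp continuous_snd)
    exact isClosed_le (hval i) (hval j)
  have hproj := isClosedMap_snd_of_compactSpace C hC
  by_cases h0 : (0 : ℝ) ∈ Prod.snd '' C
  · obtain ⟨⟨y, t⟩, hy, rfl⟩ := h0
    refine Eventually.of_forall fun _ _ => ⟨y.1, ?_, hy⟩
    exact norm_ne_zero_iff.1 (by rw [mem_sphere_zero_iff_norm.1 y.2]; exact one_ne_zero)
  · filter_upwards [hproj.isOpen_compl.mem_nhds h0] with t ht
    rintro ⟨y, hy0, hy⟩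
    have hn : 0 < ‖y‖ := norm_pos_iff.2 hy0
    refine absurd ⟨(⟨‖y‖⁻¹ • y, ?_⟩, t), ?_, rfl⟩ ht
    · rw [mem_sphere_zero_iff_norm, norm_smul, norm_inv, norm_norm, inv_mul_cancel₀ hn.ne']
    · intro j hj i
      simpa using mul_le_mul_of_nonneg_left (hy j hj i) (inv_nonneg.2 hn.le)

theorem eventually_forall_strict {d : ℕ} {ι : Type*} [Finite ι] {q : ℝ → ι → Esp d}
    (hq : ∀ i, Continuous fun t => q t i)
    (h0 : ∀ i, ∃ y : StrongDual ℝ (Esp d), ∀ j, j ≠ i → y (q 0 j) < y (q 0 i)) :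
    ∀ᶠ t in 𝓝 (0 : ℝ), ∀ i, ∃ y : StrongDual ℝ (Esp d), ∀ j, j ≠ i → y (q t j) < y (q t i) := by
  rw [eventually_all]
  intro i
  obtain ⟨y, hy⟩ := h0 i
  have : ∀ᶠ t in 𝓝 (0 : ℝ), ∀ j, j ≠ i → y (q t j) < y (q t i) := by
    rw [eventually_all]
    intro j
    by_cases hj : j = i
    · exact Eventually.of_forall fun _ h => absurd hj h
    · filter_upwards [((y.continuous.comp (hq j)).tendsto 0).eventually_lt
        ((y.continuous.comp (hq i)).tendsto 0) (hy j hj)] with t ht _ using ht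
  filter_upwards [this] with t ht using ⟨y, ht⟩

/-- The points `p i` are the vertices of the prismatoid `Q`, and the bases of `Q` are cut out by
the levels `M` and `m` of the linear functional `l`. -/
structure Prismatoid.IsRep {d : ℕ} {ι : Type*} (Q : Prismatoid d) (p : ι → Esp d)
    (l : StrongDual ℝ (Esp d)) (m M : ℝ) : Prop where
  hull : Q.P = convexHull ℝ (Set.range p)
  strict : ∀ i, ∃ y : StrongDual ℝ (Esp d), ∀ j, j ≠ i → y (p j) < y (p i)
  lt : m < M
  two : ∀ i, l (p i) = m ∨ l (p i) = M
  top : Q.Qp = convexHull ℝ (p '' {i | l (p i) = M})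
  bot : Q.Qm = convexHull ℝ (p '' {i | l (p i) = m})

theorem affineSpan_eq_top_of_levels {d : ℕ} {ι : Type*} {p : ι → Esp d}
    {l : StrongDual ℝ (Esp d)} {m M : ℝ} (hd : 2 ≤ d) (hlt : m < M)
    (hM : d ≤ polyDim (p '' {i | l (p i) = M}) + 1)
    (hm : d ≤ polyDim (p '' {i | l (p i) = m}) + 1) : affineSpan ℝ (Set.range p) = ⊤ := by
  obtain ⟨_, i, hi, rfl⟩ := nonempty_of_polyDim hd hM
  obtain ⟨_, j, hj, rfl⟩ := nonempty_of_polyDim hd hm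
  have hi' : l (p i) = M := hi
  have hj' : l (p j) = m := hj
  have hl : l ≠ 0 := by
    rintro rfl
    simp only [_root_.zero_apply] at hi' hj'
    linarith
  refine affineSpan_eq_top_of_forall_const ⟨p i, i, rfl⟩ fun y h hy => ?_
  obtain ⟨c, rfl⟩ := exists_smul_eq_of_const (y := l) (h := M) (y' := y) (h' := h) hM hl
    (by rintro _ ⟨k, hk, rfl⟩; exact hk) (by rintro _ ⟨k, -, rfl⟩; exact hy _ ⟨k, rfl⟩)
  have h1 : c * l (p i) = h := hy _ ⟨i, rfl⟩
  have h2 : c * l (p j) = h := hy _ ⟨j, rfl⟩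
  rw [hi'] at h1
  rw [hj'] at h2
  have h3 : c * (M - m) = 0 := by linarith
  rcases mul_eq_zero.1 h3 with rfl | h3
  · exact zero_smul _ _
  · linarith

theorem exists_isRep_of_levels {d : ℕ} {ι : Type*} [Finite ι] {p : ι → Esp d}
    {l : StrongDual ℝ (Esp d)} {m M : ℝ} (hd : 2 ≤ d)
    (hstrict : ∀ i, ∃ y : StrongDual ℝ (Esp d), ∀ j, j ≠ i → y (p j) < y (p i)) (hlt : m < M)
    (htwo : ∀ i, l (p i) = m ∨ l (p i) = M)
    (hM : d ≤ polyDim (p '' {i | l (p i) = M}) + 1)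
    (hm : d ≤ polyDim (p '' {i | l (p i) = m}) + 1) : ∃ Q : Prismatoid d, Q.IsRep p l m M := by
  have hspan := affineSpan_eq_top_of_levels hd hlt hM hm
  obtain ⟨x, hx⟩ := nonempty_of_polyDim hd hM
  have hl : l ≠ 0 := by
    rintro rfl
    obtain ⟨_, i, hi, rfl⟩ := nonempty_of_polyDim hd hM
    obtain ⟨_, j, hj, rfl⟩ := nonempty_of_polyDim hd hm
    have hi' : (0 : ℝ) = M := hi
    have hj' : (0 : ℝ) = m := hj
    linarith
  have hMc : ∀ x ∈ p '' {i | l (p i) = M}, l x = M := by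
    rintro _ ⟨k, hk, rfl⟩
    exact hk
  have hmc : ∀ x ∈ p '' {i | l (p i) = m}, l x = m := by
    rintro _ ⟨k, hk, rfl⟩
    exact hk
  have hfM := isFacet_contact hspan hd hl
    (fun i => by rcases htwo i with h | h <;> linarith) hM
  have hset : {i | (-l) (p i) = -m} = {i | l (p i) = m} := by
    ext i
    simp
  have hfm := isFacet_contact (y := -l) (h := -m) hspan hd (neg_ne_zero.2 hl)
    (fun i => by rw [_root_.neg_apply]; rcases htwo i with h | h <;> linarith)
    (by rwa [hset])
  rw [hset] at hfm
  have hker : ∀ {S : Set (Esp d)} {h : ℝ}, d ≤ polyDim S + 1 → (∀ x ∈ S, l x = h) →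
      (affineSpan ℝ (convexHull ℝ S)).direction = LinearMap.ker (l : Esp d →ₗ[ℝ] ℝ) := by
    intro S h hS hc
    rw [affineSpan_convexHull, direction_affineSpan]
    refine Submodule.eq_of_le_of_finrank_le (vectorSpan_le_ker hc) ?_
    rw [← polyDim_eq_finrank_vectorSpan]
    have h2 : (LinearMap.ker (l : Esp d →ₗ[ℝ] ℝ)) ≠ ⊤ := by
      rw [Ne, LinearMap.ker_eq_top]
      exact fun h => hl (ContinuousLinearMap.coe_injective h)
    have h3 := Submodule.finrank_lt h2
    rw [finrank_euclideanSpace_fin] at h3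
    omega
  refine ⟨{ P := convexHull ℝ (Set.range p)
            Qp := convexHull ℝ (p '' {i | l (p i) = M})
            Qm := convexHull ℝ (p '' {i | l (p i) = m})
            poly := ⟨(Set.finite_range p).toFinset, by simp⟩
            dimP := by rw [polyDim_convexHull, polyDim_eq_of_affineSpan_eq_top hspan]
            facetP := hfM
            facetM := hfm
            ne := fun h => ?_
            parallel := (hker hM hMc).trans (hker hm hmc).symm
            cover := fun x hx => ?_ }, ⟨rfl, hstrict, hlt, htwo, rfl, rfl⟩⟩
  · have h1 := subset_convexHull ℝ _ hx
    have h2 := h1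
    rw [h] at h2
    linarith [eq_of_mem_convexHull hMc h1, eq_of_mem_convexHull hmc h2]
  · obtain ⟨i, rfl⟩ := extremePoints_convexHull_subset hx
    rcases htwo i with h | h
    · exact Or.inr (subset_convexHull ℝ _ ⟨i, h, rfl⟩)
    · exact Or.inl (subset_convexHull ℝ _ ⟨i, h, rfl⟩)

theorem IsPolytope.finite_extremePoints {d : ℕ} {P : Set (Esp d)} (hP : IsPolytope P) :
    (Set.extremePoints ℝ P).Finite := by
  obtain ⟨S, rfl⟩ := hP
  exact S.finite_toSet.subset extremePoints_convexHull_subset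

theorem IsPolytope.convexHull_extremePoints {d : ℕ} {P : Set (Esp d)} (hP : IsPolytope P) :
    P = convexHull ℝ (Set.extremePoints ℝ P) := by
  have hfin := hP.finite_extremePoints
  obtain ⟨S, rfl⟩ := hP
  have h1 := closure_convexHull_extremePoints (s := convexHull ℝ (S : Set (Esp d)))
    (S.finite_toSet.isCompact_convexHull ℝ) (convex_convexHull ℝ _)
  rw [(hfin.isClosed_convexHull ℝ).closure_eq] at h1
  exact h1.symm

theorem exists_strict_of_mem_extremePoints {d : ℕ} {P : Set (Esp d)} (hP : IsPolytope P)
    {x : Esp d} (hx : x ∈ Set.extremePoints ℝ P) :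
    ∃ y : StrongDual ℝ (Esp d), ∀ z ∈ Set.extremePoints ℝ P, z ≠ x → y z < y x := by
  have hconv : Convex ℝ P := by
    obtain ⟨S, rfl⟩ := hP
    exact convex_convexHull ℝ _
  have h1 : x ∉ convexHull ℝ (Set.extremePoints ℝ P \ {x}) := fun h =>
    (hconv.mem_extremePoints_iff_mem_sdiff_convexHull_sdiff.1 hx).2
      (convexHull_mono (Set.sdiff_subset_sdiff_left extremePoints_subset) h)
  obtain ⟨y, u, hu, hux⟩ := geometric_hahn_banach_closed_point (convex_convexHull ℝ _)
    (hP.finite_extremePoints.sdiff.isClosed_convexHull ℝ) h1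
  exact ⟨y, fun z hz hzx => (hu z (subset_convexHull ℝ _ ⟨hz, hzx⟩)).trans hux⟩

theorem Prismatoid.nonempty {d : ℕ} (Q : Prismatoid d) : Q.P.Nonempty := by
  obtain ⟨x, hx⟩ := Q.facetP.2.2.1
  exact ⟨x, Q.facetP.1.subset hx⟩

theorem Prismatoid.exists_isRep {d : ℕ} (Q : Prismatoid d) :
    ∃ l m M, Q.IsRep (Subtype.val : Set.extremePoints ℝ Q.P → Esp d) l m M := by
  have hull : Q.P = convexHull ℝ (Set.range (Subtype.val : Set.extremePoints ℝ Q.P → Esp d)) := by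
    rw [Subtype.range_coe]
    exact Q.poly.convexHull_extremePoints
  obtain ⟨y, M, hy0, hle, hiff⟩ := Q.facetP.exists_functional
  have hspan : affineSpan ℝ Q.P = ⊤ := affineSpan_eq_top_of_polyDim_eq Q.nonempty Q.dimP
  have hpar : vectorSpan ℝ Q.Qm ≤ LinearMap.ker (y : Esp d →ₗ[ℝ] ℝ) := by
    rw [← direction_affineSpan, ← Q.parallel, direction_affineSpan]
    exact vectorSpan_le_ker fun x hx => ((hiff x).1 hx).2
  obtain ⟨b, hb⟩ := Q.facetM.2.2.1
  have hbot : ∀ x ∈ Q.Qm, y x = y b := fun x hx => by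
    have := hpar (vsub_mem_vectorSpan ℝ hx hb)
    rw [LinearMap.mem_ker, vsub_eq_sub, map_sub] at this
    exact sub_eq_zero.1 this
  have hQm := Q.facetM.1.subset
  have hlt : y b < M := by
    refine (hle b (hQm hb)).lt_of_ne fun h => Q.ne ?_
    refine Q.facetP.eq_of_subset hspan Q.facetM Q.facetM.2.2.1 ?_ ?_ subset_rfl
    · rw [Q.facetM.2.2.2, Q.dimP]
    · exact fun x hx => (hiff x).2 ⟨hQm hx, (hbot x hx).trans h⟩
  have hcov : ∀ x : Set.extremePoints ℝ Q.P, x.1 ∈ Q.Qp ∨ x.1 ∈ Q.Qm := fun x => Q.cover x.2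
  refine ⟨y, y b, M, hull, fun x => ?_, hlt, fun x => ?_, ?_, ?_⟩
  · obtain ⟨z, hz⟩ := exists_strict_of_mem_extremePoints Q.poly x.2
    exact ⟨z, fun j hj => hz j j.2 fun h => hj (Subtype.ext h)⟩
  · rcases hcov x with h | h
    · exact Or.inr ((hiff x).1 h).2
    · exact Or.inl (hbot x h)
  · obtain ⟨-, -, -, -, -, h⟩ := (hull ▸ Q.facetP : IsFacet (convexHull ℝ (Set.range
      (Subtype.val : Set.extremePoints ℝ Q.P → Esp d))) Q.Qp).exists_contact
    have hset : {i : Set.extremePoints ℝ Q.P | i.1 ∈ Q.Qp} = {i | y i.1 = M} :=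
      Set.ext fun i => ⟨fun hi => ((hiff i).1 hi).2,
        fun hi => (hiff i).2 ⟨extremePoints_subset i.2, hi⟩⟩
    rwa [hset] at h
  · obtain ⟨-, -, -, -, -, h⟩ := (hull ▸ Q.facetM : IsFacet (convexHull ℝ (Set.range
      (Subtype.val : Set.extremePoints ℝ Q.P → Esp d))) Q.Qm).exists_contact
    have hset : {i : Set.extremePoints ℝ Q.P | i.1 ∈ Q.Qm} = {i | y i.1 = y b} :=
      Set.ext fun i => ⟨fun hi => hbot i hi,
        fun hi => (hcov i).resolve_left fun hi' => by
          have h1 := ((hiff i).1 hi').2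
          have h2 : y i.1 = y b := hi
          linarith⟩
    rwa [hset] at h

namespace Prismatoid

variable {d : ℕ} {ι : Type*} {Q : Prismatoid d} {p : ι → Esp d} {l : StrongDual ℝ (Esp d)}
  {m M : ℝ}

theorem IsRep.span (hR : Q.IsRep p l m M) : affineSpan ℝ (Set.range p) = ⊤ := by
  rw [← affineSpan_convexHull, ← hR.hull]
  exact affineSpan_eq_top_of_polyDim_eq Q.nonempty Q.dimP

theorem IsRep.dim_top (hR : Q.IsRep p l m M) : polyDim (p '' {i | l (p i) = M}) + 1 = d := by
  rw [← polyDim_convexHull, ← hR.top, Q.facetP.2.2.2, Q.dimP]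

theorem IsRep.dim_bot (hR : Q.IsRep p l m M) : polyDim (p '' {i | l (p i) = m}) + 1 = d := by
  rw [← polyDim_convexHull, ← hR.bot, Q.facetM.2.2.2, Q.dimP]

theorem IsRep.injective (hR : Q.IsRep p l m M) : Function.Injective p := by
  intro i j hij
  by_contra hne
  obtain ⟨y, hy⟩ := hR.strict i
  have := hy j (Ne.symm hne)
  rw [hij] at this
  exact lt_irrefl _ this

theorem IsRep.nverts_eq (hR : Q.IsRep p l m M) : Q.nverts = Nat.card ι := by
  have h : Set.extremePoints ℝ Q.P = Set.range p := by
    rw [hR.hull]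
    refine extremePoints_convexHull_subset.antisymm ?_
    rintro _ ⟨i, rfl⟩
    obtain ⟨y, hy⟩ := hR.strict i
    have hle : ∀ j, y (p j) ≤ y (p i) := fun j => by
      rcases eq_or_ne j i with rfl | hj
      · exact le_rfl
      · exact (hy j hj).le
    have hmem := subset_convexHull ℝ _ (Set.mem_range_self (f := p) i)
    have huniq : ∀ x ∈ convexHull ℝ (Set.range p), y x = y (p i) → x = p i := fun x hx hxi => by
      have h1 := (mem_convexHull_contact hle hx).2 hxi
      have h2 : p '' {j | y (p j) = y (p i)} = {p i} := by
        refine Set.eq_singleton_iff_unique_mem.2 ⟨⟨i, rfl, rfl⟩, ?_⟩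
        rintro _ ⟨j, hj, rfl⟩
        by_contra hne
        exact (hy j fun h => hne (h ▸ rfl)).ne hj
      rwa [h2, convexHull_singleton, Set.mem_singleton_iff] at h1
    refine mem_extremePoints.2 ⟨hmem, fun x₁ hx₁ x₂ hx₂ ⟨a, b, ha, hb, hab, he⟩ => ?_⟩
    have e1 := le_of_mem_convexHull (h := y (p i)) (by rintro _ ⟨j, rfl⟩; exact hle j) hx₁
    have e2 := le_of_mem_convexHull (h := y (p i)) (by rintro _ ⟨j, rfl⟩; exact hle j) hx₂
    have e3 : a * y x₁ + b * y x₂ = y (p i) := by rw [← he]; simp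
    have e4 : y (p i) = a * y (p i) + b * y (p i) := by rw [← add_mul, hab, one_mul]
    exact ⟨huniq x₁ hx₁ (by nlinarith), huniq x₂ hx₂ (by nlinarith)⟩
  rw [Prismatoid.nverts, h, ← Set.image_univ, Set.ncard_image_of_injective _ hR.injective,
    Set.ncard_univ]

/-- The prismatoid with the two bases exchanged. -/
def swap (Q : Prismatoid d) : Prismatoid d where
  P := Q.P
  Qp := Q.Qm
  Qm := Q.Qp
  poly := Q.poly
  dimP := Q.dimP
  facetP := Q.facetM
  facetM := Q.facetP
  ne := Q.ne.symm
  parallel := Q.parallel.symm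
  cover := by
    rw [Set.union_comm]
    exact Q.cover

theorem swap_width (Q : Prismatoid d) : Q.swap.width = Q.width :=
  SimpleGraph.dist_comm

theorem IsRep.swap (hR : Q.IsRep p l m M) : Q.swap.IsRep p (-l) (-M) (-m) where
  hull := hR.hull
  strict := hR.strict
  lt := neg_lt_neg hR.lt
  two i := by simpa using (hR.two i).symm
  top := by simpa using! hR.bot
  bot := by simpa using! hR.top

theorem IsRep.reachable [Finite ι] (hR : Q.IsRep p l m M) (hd : 2 ≤ d)
    (F G : {F : Set (Esp d) // IsFacet Q.P F}) : (dualGraph Q.P).Reachable F G := by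
  have hspan := hR.span
  have : ∀ P, P = convexHull ℝ (Set.range p) → ∀ F G : {F : Set (Esp d) // IsFacet P F},
      (dualGraph P).Reachable F G := by
    rintro _ rfl
    exact dualGraph_reachable hspan hd
  exact this _ hR.hull F G

end Prismatoid

theorem SimpleGraph.Walk.exists_map_length_le {V W : Type*} {G : SimpleGraph V} {H : SimpleGraph W}
    {f : V → W} (hf : ∀ a b, G.Adj a b → f a = f b ∨ H.Adj (f a) (f b)) {u v : V}
    (w : G.Walk u v) : ∃ w' : H.Walk (f u) (f v), w'.length ≤ w.length := by
  induction w with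
  | nil => exact ⟨SimpleGraph.Walk.nil, le_rfl⟩
  | cons hadj w ih =>
    obtain ⟨w', hw'⟩ := ih
    rcases hf _ _ hadj with h | h
    · rw [h]
      exact ⟨w', hw'.trans (Nat.le_succ _)⟩
    · exact ⟨SimpleGraph.Walk.cons h w', Nat.succ_le_succ hw'⟩

theorem SimpleGraph.dist_map_le {V W : Type*} {G : SimpleGraph V} {H : SimpleGraph W}
    {f : V → W} (hf : ∀ a b, G.Adj a b → f a = f b ∨ H.Adj (f a) (f b)) {u v : V}
    (h : G.Reachable u v) : H.dist (f u) (f v) ≤ G.dist u v := by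
  obtain ⟨w, hw⟩ := h.exists_walk_length_eq_dist
  obtain ⟨w', hw'⟩ := w.exists_map_length_le hf
  exact (SimpleGraph.dist_le w').trans (hw'.trans hw.le)

theorem SimpleGraph.dist_map_add_one_le {V W : Type*} {G : SimpleGraph V} {H : SimpleGraph W}
    {f : V → W} (hf : ∀ a b, G.Adj a b → f a = f b ∨ H.Adj (f a) (f b)) {u v : V}
    (hu : ∀ b, G.Adj u b → f b = f u) (huv : u ≠ v) (h : G.Reachable u v) :
    H.dist (f u) (f v) + 1 ≤ G.dist u v := by
  obtain ⟨w, hw⟩ := h.exists_walk_length_eq_dist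
  rw [← hw]
  cases w with
  | nil => exact absurd rfl huv
  | cons hadj w =>
    obtain ⟨w', hw'⟩ := w.exists_map_length_le hf
    rw [← hu _ hadj]
    exact Nat.succ_le_succ ((SimpleGraph.dist_le w').trans hw')

theorem polyDim_insert_le_polyDim_insert {d : ℕ} {x x' : Esp d} {S : Set (Esp d)}
    (hx : x ∉ affineSpan ℝ S) : polyDim (insert x' S) ≤ polyDim (insert x S) := by
  rcases S.eq_empty_or_nonempty with rfl | hS
  · simp [polyDim_singleton]
  · exact (polyDim_insert_le x' S).trans (polyDim_lt_polyDim_insert hS hx)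

theorem polyDim_le_of_subset_affineSpan {d : ℕ} {S T : Set (Esp d)}
    (h : S ⊆ affineSpan ℝ T) : polyDim S ≤ polyDim T :=
  Submodule.finrank_mono (AffineSubspace.direction_le (affineSpan_le.2 h))

theorem image_eq_insert_image {α β : Type*} (f : α → β) {J : Set α} {a : α} (ha : a ∈ J) :
    f '' J = insert (f a) (f '' (J \ {a})) := by
  rw [← Set.image_insert_eq, Set.insert_sdiff_singleton, Set.insert_eq_of_mem ha]

namespace Prismatoid

variable {d : ℕ} {ι : Type*} {Q : Prismatoid d} {p : ι → Esp d} {l : StrongDual ℝ (Esp d)}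
  {m M : ℝ}

theorem IsRep.isFacet_iff (hR : Q.IsRep p l m M) {F : Set (Esp d)} :
    IsFacet Q.P F ↔ IsFacet (convexHull ℝ (Set.range p)) F := by
  rw [hR.hull]

theorem IsRep.affineSpan_eq_top (hR : Q.IsRep p l m M) : affineSpan ℝ Q.P = ⊤ := by
  rw [hR.hull, affineSpan_convexHull, hR.span]

theorem IsRep.exists_contact (hR : Q.IsRep p l m M) {F : Set (Esp d)} (hF : IsFacet Q.P F) :
    ∃ (y : StrongDual ℝ (Esp d)) (h : ℝ), y ≠ 0 ∧ (∀ i, y (p i) ≤ h) ∧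
      ∀ i, p i ∈ F ↔ y (p i) = h := by
  obtain ⟨y, h, h1, h2, h3, -⟩ := (hR.isFacet_iff.1 hF).exists_contact
  exact ⟨y, h, h1, h2, h3⟩

theorem IsRep.dim_facet (hR : Q.IsRep p l m M) {F : Set (Esp d)} (hF : IsFacet Q.P F) :
    polyDim (p '' {i | p i ∈ F}) + 1 = d := by
  obtain ⟨-, -, -, -, -, h⟩ := (hR.isFacet_iff.1 hF).exists_contact
  rw [← polyDim_convexHull, ← h, (hR.isFacet_iff.1 hF).polyDim_add_one hR.span]

theorem IsRep.eq_of_subset (hR : Q.IsRep p l m M) (hd : 2 ≤ d) {F G S : Set (Esp d)}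
    (hF : IsFacet Q.P F) (hG : IsFacet Q.P G) (hdim : d ≤ polyDim S + 1) (hSF : S ⊆ F)
    (hSG : S ⊆ G) : F = G :=
  hF.eq_of_subset hR.affineSpan_eq_top hG (nonempty_of_polyDim hd hdim) hdim hSF hSG

theorem IsRep.exists_isFacet (hR : Q.IsRep p l m M) (hd : 2 ≤ d) {J : Set ι}
    {y : StrongDual ℝ (Esp d)} (hy0 : y ≠ 0) (hJ : ∀ j ∈ J, ∀ i, y (p i) ≤ y (p j))
    (hdim : d ≤ polyDim (p '' J) + 1) : ∃ F, IsFacet Q.P F ∧ p '' J ⊆ F := by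
  obtain ⟨F, hF, h⟩ := exists_isFacet_of_supporting hR.span hd hy0 hJ hdim
  exact ⟨F, hR.isFacet_iff.2 hF, h⟩

theorem IsRep.mem_top_iff (hR : Q.IsRep p l m M) (i : ι) : p i ∈ Q.Qp ↔ l (p i) = M := by
  rw [hR.top, mem_convexHull_contact (fun i => ?_) (subset_convexHull ℝ _ ⟨i, rfl⟩)]
  rcases hR.two i with h | h <;> linarith [hR.lt]

theorem IsRep.mem_bot_iff (hR : Q.IsRep p l m M) (i : ι) : p i ∈ Q.Qm ↔ l (p i) = m := by
  simpa using! hR.swap.mem_top_iff i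

theorem IsRep.dim_inter_of_adj (hR : Q.IsRep p l m M) {F G : {F : Set (Esp d) // IsFacet Q.P F}}
    (h : (dualGraph Q.P).Adj F G) : polyDim (p '' {i | p i ∈ F.1 ∧ p i ∈ G.1}) + 2 = d := by
  rw [← polyDim_convexHull, ← (hR.isFacet_iff.1 F.2).inter_eq (hR.isFacet_iff.1 G.2),
    (dualGraph_adj_iff.1 h).2, Q.dimP]

theorem IsRep.eq_or_adj (hR : Q.IsRep p l m M) (hd : 2 ≤ d)
    {F G : {F : Set (Esp d) // IsFacet Q.P F}} {S : Set (Esp d)} (hSF : S ⊆ F.1) (hSG : S ⊆ G.1)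
    (hdim : d ≤ polyDim S + 2) : F = G ∨ (dualGraph Q.P).Adj F G := by
  rcases eq_or_ne F G with h | h
  · exact Or.inl h
  · exact Or.inr (dualGraph_adj_of_subset hd hR.affineSpan_eq_top h hSF hSG hdim)

/-- Pulling a vertex `p a` of the top base outwards, inside the hyperplane of that base. -/
theorem IsRep.exists_pull [Finite ι] (hR : Q.IsRep p l m M) (hd : 2 ≤ d) {a : ι}
    (ha : l (p a) = M) (haff : p a ∈ affineSpan ℝ (p '' ({i | l (p i) = M} \ {a}))) :
    ∃ (Q' : Prismatoid d) (p' : ι → Esp d), Q'.IsRep p' l m M ∧ l (p' a) = M ∧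
      p' a ∈ affineSpan ℝ (p' '' ({i | l (p' i) = M} \ {a})) ∧
      Q.width ≤ Q'.width ∧ ∀ F, IsFacet Q'.P F → F ≠ Q'.Qp → p' a ∈ F →
        p' a ∉ affineSpan ℝ (p' '' ({i | p' i ∈ F} \ {a})) := by
  classical
  set A : Set ι := {i | l (p i) = M} with hA
  have hA₀ : (A \ {a}).Nonempty := by
    have := (affineSpan_nonempty (k := ℝ)).1 ⟨_, haff⟩
    simpa using this
  obtain ⟨c, hc, hgen⟩ := exists_mem_convexHull_generic p hA₀
  have hlc : l c = M := eq_of_mem_convexHull (by rintro _ ⟨i, hi, rfl⟩; exact hi.1) hc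
  let q : ℝ → ι → Esp d := fun t => Function.update p a (p a + t • (p a - c))
  have hqa : ∀ t, q t a = p a + t • (p a - c) := fun t => Function.update_self _ _ _
  have hqi : ∀ t i, i ≠ a → q t i = p i := fun t i hi => Function.update_of_ne hi _ _
  have hq0 : q 0 = p := by simp [q]
  have hq : ∀ i, Continuous fun t => q t i := fun i => by
    rcases eq_or_ne i a with rfl | hi
    · simp only [hqa]
      fun_prop
    · simp only [hqi _ i hi]
      exact continuous_const
  have hev := (eventually_forall_supporting hq).and
    (eventually_forall_strict hq (by rw [hq0]; exact hR.strict))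
  obtain ⟨t, ⟨hsupp, hstrict⟩, ht⟩ :=
    ((hev.filter_mono nhdsWithin_le_nhds).and (self_mem_nhdsWithin (s := Set.Ioi (0 : ℝ)))).exists
  rw [hq0] at hsupp
  replace ht : 0 < t := ht
  have himg : ∀ J : Set ι, a ∉ J → q t '' J = p '' J := fun J hJ =>
    Set.image_congr fun i hi => hqi t i (by rintro rfl; exact hJ hi)
  have hval : ∀ y : StrongDual ℝ (Esp d), y (q t a) = y (p a) + t * (y (p a) - y c) := fun y => by
    rw [hqa]
    simp
  have hl : ∀ i, l (q t i) = l (p i) := fun i => by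
    rcases eq_or_ne i a with rfl | hi
    · rw [hval, hlc, ha]
      ring
    · rw [hqi t i hi]
  have haA : a ∉ A \ {a} := fun h => h.2 rfl
  have hdimA : polyDim (p '' A) ≤ polyDim (q t '' A) := by
    refine (polyDim_le_of_subset_affineSpan (T := q t '' (A \ {a})) ?_).trans
      (polyDim_mono (Set.image_mono Set.sdiff_subset))
    rw [himg _ haA]
    rintro _ ⟨i, hi, rfl⟩
    rcases eq_or_ne i a with rfl | hia
    · exact haff
    · exact subset_affineSpan ℝ _ ⟨i, ⟨hi, hia⟩, rfl⟩
  have hdimA' : d ≤ polyDim (q t '' A) + 1 := hR.dim_top.ge.trans (Nat.succ_le_succ hdimA)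
  obtain ⟨Q', hR'⟩ := exists_isRep_of_levels (l := l) (m := m) (M := M) hd hstrict hR.lt
    (fun i => by rw [hl]; exact hR.two i)
    (by simp only [hl]; exact hdimA')
    (by
      simp only [hl]
      rw [himg _ (by rw [Set.mem_ofPred_eq, ha]; exact hR.lt.ne')]
      exact hR.dim_bot.ge)
  have key : ∀ F, IsFacet Q'.P F → F ≠ Q'.Qp → q t a ∈ F → ∃ (y : StrongDual ℝ (Esp d)) (h : ℝ),
      (∀ i, y (q t i) ≤ h) ∧ (∀ i, q t i ∈ F ↔ y (q t i) = h) ∧ y (p a) < h := by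
    intro F hF hFne haF
    obtain ⟨y, h, -, hle, hiff⟩ := hR'.exists_contact hF
    refine ⟨y, h, hle, hiff, ?_⟩
    have hyc : y c ≤ h := le_of_mem_convexHull
      (by rintro _ ⟨i, hi, rfl⟩; rw [← hqi t i hi.2]; exact hle i) hc
    have hya := hval y
    rw [(hiff a).1 haF] at hya
    rcases hyc.lt_or_eq with hyc | hyc
    · nlinarith
    · refine absurd (hR'.eq_of_subset hd hF Q'.facetP (S := q t '' A) hdimA' ?_ ?_) hFne
      · rintro _ ⟨i, hi, rfl⟩
        rcases eq_or_ne i a with rfl | hia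
        · exact haF
        · rw [hiff, hqi t i hia]
          exact hgen y h (fun j hj => by rw [← hqi t j hj.2]; exact hle j) hyc i ⟨hi, hia⟩
      · rintro _ ⟨i, hi, rfl⟩
        rw [hR'.mem_top_iff, hl]
        exact hi
  have hnot : ∀ F, IsFacet Q'.P F → F ≠ Q'.Qp → q t a ∈ F → ∀ J : Set ι, J ⊆ {i | q t i ∈ F} →
      p a ∉ affineSpan ℝ (p '' (J \ {a})) := by
    intro F hF hFne haF J hJ hmem
    obtain ⟨y, h, -, hiff, hlt⟩ := key F hF hFne haF
    refine hlt.ne (eq_of_mem_affineSpan ?_ hmem)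
    rintro _ ⟨i, hi, rfl⟩
    rw [← hqi t i hi.2]
    exact (hiff i).1 (hJ hi.1)
  have hdimle : ∀ F, IsFacet Q'.P F → F ≠ Q'.Qp → ∀ J : Set ι, J ⊆ {i | q t i ∈ F} →
      polyDim (q t '' J) ≤ polyDim (p '' J) := by
    intro F hF hFne J hJ
    by_cases haJ : a ∈ J
    · rw [image_eq_insert_image _ haJ, image_eq_insert_image p haJ, himg _ fun h => h.2 rfl]
      exact polyDim_insert_le_polyDim_insert (hnot F hF hFne (hJ haJ) J hJ)
    · rw [himg J haJ]
  have hdimF : ∀ F, IsFacet Q'.P F → d ≤ polyDim (p '' {i | q t i ∈ F}) + 1 := by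
    intro F hF
    rcases eq_or_ne F Q'.Qp with rfl | hFne
    · simp only [hR'.mem_top_iff, hl]
      exact hR.dim_top.ge
    · have h1 := hdimle F hF hFne _ subset_rfl
      have h2 := hR'.dim_facet hF
      omega
  have hsup : ∀ F, IsFacet Q'.P F → ∃ y : StrongDual ℝ (Esp d), y ≠ 0 ∧
      ∀ j ∈ {i | q t i ∈ F}, ∀ i, y (p i) ≤ y (p j) := fun F hF => by
    obtain ⟨y, h, hy0, hle, hiff⟩ := hR'.exists_contact hF
    exact hsupp _ ⟨y, hy0, fun j hj i => (hle i).trans_eq ((hiff j).1 hj).symm⟩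
  have hex : ∀ F, IsFacet Q'.P F → ∃ G, IsFacet Q.P G ∧ p '' {i | q t i ∈ F} ⊆ G := fun F hF => by
    obtain ⟨y, hy0, hy⟩ := hsup F hF
    exact hR.exists_isFacet hd hy0 hy (hdimF F hF)
  choose φ hφ hφsub using hex
  refine ⟨Q', q t, hR', by rw [hl, ha], ?_, ?_, fun F hF hFne haF hmem => ?_⟩
  · simp only [hl]
    rw [himg _ haA, hqa]
    have := AffineMap.lineMap_mem (1 + t) (convexHull_subset_affineSpan _ hc) haff
    convert this using 1
    rw [AffineMap.lineMap_apply, vsub_eq_sub, vadd_eq_add]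
    module
  · let f : {F : Set (Esp d) // IsFacet Q'.P F} → {F : Set (Esp d) // IsFacet Q.P F} :=
      fun F => ⟨φ F.1 F.2, hφ F.1 F.2⟩
    have hfp : f ⟨Q'.Qp, Q'.facetP⟩ = ⟨Q.Qp, Q.facetP⟩ := by
      refine Subtype.ext (hR.eq_of_subset hd (hφ _ _) Q.facetP (hdimF _ Q'.facetP)
        (hφsub _ _) ?_)
      rintro _ ⟨i, hi, rfl⟩
      rw [Set.mem_ofPred_eq, hR'.mem_top_iff, hl] at hi
      exact (hR.mem_top_iff i).2 hi
    have hfm : f ⟨Q'.Qm, Q'.facetM⟩ = ⟨Q.Qm, Q.facetM⟩ := by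
      refine Subtype.ext (hR.eq_of_subset hd (hφ _ _) Q.facetM (hdimF _ Q'.facetM)
        (hφsub _ _) ?_)
      rintro _ ⟨i, hi, rfl⟩
      rw [Set.mem_ofPred_eq, hR'.mem_bot_iff, hl] at hi
      exact (hR.mem_bot_iff i).2 hi
    have := SimpleGraph.dist_map_le (f := f) (H := dualGraph Q.P) (G := dualGraph Q'.P) ?_
      (hR'.reachable hd ⟨Q'.Qp, Q'.facetP⟩ ⟨Q'.Qm, Q'.facetM⟩)
    · rwa [hfp, hfm] at this
    · intro F G hFG
      refine hR.eq_or_adj hd (S := p '' {i | q t i ∈ F.1 ∧ q t i ∈ G.1})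
        ((Set.image_mono fun i hi => hi.1).trans (hφsub F.1 F.2))
        ((Set.image_mono fun i hi => hi.2).trans (hφsub G.1 G.2)) ?_
      have h1 := hR'.dim_inter_of_adj hFG
      rcases eq_or_ne F.1 Q'.Qp with hF | hF
      · have := hdimle G.1 G.2 (fun h => hFG.ne (Subtype.ext (hF.trans h.symm)))
          {i | q t i ∈ F.1 ∧ q t i ∈ G.1} fun i hi => hi.2
        omega
      · have := hdimle F.1 F.2 hF {i | q t i ∈ F.1 ∧ q t i ∈ G.1} fun i hi => hi.1
        omega
  · obtain ⟨y, h, hle, hiff, hlt⟩ := key F hF hFne haF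
    obtain ⟨z, hz0, hz⟩ := hsup F hF
    have haN : a ∉ {i | q t i ∈ F} \ {a} := fun h => h.2 rfl
    have hN : d ≤ polyDim (p '' ({i | q t i ∈ F} \ {a})) + 1 := by
      rw [← himg _ haN]
      refine (hR'.dim_facet hF).ge.trans (Nat.succ_le_succ (polyDim_le_of_subset_affineSpan ?_))
      rintro _ ⟨i, hi, rfl⟩
      rcases eq_or_ne i a with rfl | hia
      · exact hmem
      · exact subset_affineSpan ℝ _ ⟨i, ⟨hi, hia⟩, rfl⟩
    obtain ⟨_, n, hn, rfl⟩ := nonempty_of_polyDim hd hN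
    have hza : ∀ i ∈ {i | q t i ∈ F}, z (p i) = z (p a) := fun i hi =>
      le_antisymm (hz a haF i) (hz i hi a)
    have hyN : ∀ i ∈ {i | q t i ∈ F} \ {a}, y (p i) = h := fun i hi => by
      rw [← hqi t i hi.2]
      exact (hiff i).1 hi.1
    obtain ⟨k, rfl⟩ := exists_smul_eq_of_const (y := z) (y' := y) (h := z (p a)) (h' := h) hN hz0
      (by rintro _ ⟨i, hi, rfl⟩; exact hza i hi.1) (by rintro _ ⟨i, hi, rfl⟩; exact hyN i hi)
    have h1 : k * z (p n) = h := hyN n hn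
    have h2 : k * z (p a) < h := hlt
    rw [hza n hn.1] at h1
    linarith

end Prismatoid

section Suspension

variable {d : ℕ} (e : (Esp d × ℝ) ≃L[ℝ] Esp (d + 1))

/-- The linear functional `(x, r) ↦ y x + s * r`. -/
def suspDual (y : StrongDual ℝ (Esp d)) (s : ℝ) : StrongDual ℝ (Esp (d + 1)) :=
  (y.coprod (s • ContinuousLinearMap.id ℝ ℝ)).comp (e.symm : Esp (d + 1) →L[ℝ] Esp d × ℝ)

/-- The projection to the hyperplane in which the suspension is based. -/
def suspProj : Esp (d + 1) →ₗ[ℝ] Esp d :=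
  LinearMap.fst ℝ (Esp d) ℝ ∘ₗ (e.symm : Esp (d + 1) →ₗ[ℝ] Esp d × ℝ)

theorem suspDual_apply (y : StrongDual ℝ (Esp d)) (s : ℝ) (x : Esp d) (r : ℝ) :
    suspDual e y s (e (x, r)) = y x + s * r := by
  simp [suspDual]

theorem suspProj_apply (x : Esp d) (r : ℝ) : suspProj e (e (x, r)) = x := by
  simp [suspProj]

theorem exists_eq_suspDual (z : StrongDual ℝ (Esp (d + 1))) : ∃ y s, z = suspDual e y s := by
  refine ⟨(z.comp (e : Esp d × ℝ →L[ℝ] Esp (d + 1))).comp (ContinuousLinearMap.inl ℝ (Esp d) ℝ),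
    z (e (0, 1)), ?_⟩
  ext x
  obtain ⟨⟨x, r⟩, rfl⟩ := e.surjective x
  rw [suspDual_apply]
  have h1 : ((x, r) : Esp d × ℝ) = (x, 0) + r • ((0, 1) : Esp d × ℝ) := by simp
  rw [h1, map_add, map_add, map_smul, map_smul, smul_eq_mul, mul_comm]
  rfl

theorem suspDual_smul (c : ℝ) (y : StrongDual ℝ (Esp d)) :
    suspDual e (c • y) 0 = c • suspDual e y 0 := by
  ext x
  obtain ⟨⟨x, r⟩, rfl⟩ := e.surjective x
  simp [suspDual_apply]

theorem finrank_vectorSpan_eq_add (S : Set (Esp (d + 1))) :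
    polyDim S = polyDim (suspProj e '' S) +
      Module.finrank ℝ (LinearMap.ker ((suspProj e).domRestrict (vectorSpan ℝ S))) := by
  have h1 := LinearMap.finrank_range_add_finrank_ker ((suspProj e).domRestrict (vectorSpan ℝ S))
  rw [LinearMap.range_domRestrict] at h1
  have h2 := (suspProj e).toAffineMap.map_vectorSpan (s := S)
  rw [LinearMap.toAffineMap_linear, LinearMap.coe_toAffineMap] at h2
  rw [polyDim_eq_finrank_vectorSpan, polyDim_eq_finrank_vectorSpan, ← h1, h2]

theorem polyDim_le_polyDim_proj_add_one (S : Set (Esp (d + 1))) :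
    polyDim S ≤ polyDim (suspProj e '' S) + 1 := by
  rw [finrank_vectorSpan_eq_add e S]
  refine Nat.add_le_add_left ?_ _
  have hsurj : Function.Surjective (suspProj e) := fun x => ⟨e (x, 0), suspProj_apply e x 0⟩
  have h1 := LinearMap.finrank_range_add_finrank_ker (suspProj e)
  rw [LinearMap.range_eq_top.2 hsurj, finrank_top, finrank_euclideanSpace_fin,
    finrank_euclideanSpace_fin] at h1
  have h2 : Module.finrank ℝ (LinearMap.ker ((suspProj e).domRestrict (vectorSpan ℝ S))) ≤
      Module.finrank ℝ (LinearMap.ker (suspProj e)) := by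
    refine LinearMap.finrank_le_finrank_of_injective
      (f := ((vectorSpan ℝ S).subtype ∘ₗ Submodule.subtype _).codRestrict _ fun x => ?_) ?_
    · exact LinearMap.mem_ker.2 (LinearMap.mem_ker.1 x.2)
    · intro x y hxy
      have h3 := Subtype.ext_iff.1 hxy
      exact Subtype.ext (Subtype.ext h3)
  omega

theorem polyDim_le_polyDim_proj {S : Set (Esp (d + 1))} {y : StrongDual ℝ (Esp d)} {s h : ℝ}
    (hs : s ≠ 0) (hy : ∀ x ∈ S, suspDual e y s x = h) : polyDim S ≤ polyDim (suspProj e '' S) := by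
  rw [finrank_vectorSpan_eq_add e S]
  have : LinearMap.ker ((suspProj e).domRestrict (vectorSpan ℝ S)) = ⊥ := by
    rw [LinearMap.ker_eq_bot']
    rintro ⟨x, hx⟩ hx0
    obtain ⟨⟨w, r⟩, rfl⟩ := e.surjective x
    have h1 : suspDual e y s (e (w, r)) = 0 := vectorSpan_le_ker hy hx
    have h2 : w = 0 := by simpa [suspProj_apply] using hx0
    rw [suspDual_apply, h2, map_zero, zero_add] at h1
    have h3 : r = 0 := (mul_eq_zero.1 h1).resolve_left hs
    simp [h2, h3]
  rw [this, finrank_bot, add_zero]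

variable {ι : Type*}

open Classical in
/-- The heights of the points of the suspension: the vertex `v` is split into two copies at
heights `1` and `-1`, and `a` is lifted to height `t`. -/
def suspHeight (a v : ι) (t : ℝ) : Option ι → ℝ
  | none => 1
  | some i => if i = v then -1 else if i = a then t else 0

/-- The vertices of the perturbed one-point suspension. -/
def suspPoint (p : ι → Esp d) (a v : ι) (t : ℝ) (o : Option ι) : Esp (d + 1) :=
  e (p (o.getD v), suspHeight a v t o)

/-- The trace on the original vertex set of a set of vertices of the suspension. -/
def suspCore (v : ι) (J : Set (Option ι)) : Set ι := {i | some i ∈ J ∧ (i = v → none ∈ J)}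

theorem suspHeight_none (a v : ι) (t : ℝ) : suspHeight a v t none = 1 := rfl

theorem suspHeight_self (a v : ι) (t : ℝ) : suspHeight a v t (some v) = -1 := by
  simp [suspHeight]

theorem suspHeight_lift {a v : ι} (hav : a ≠ v) (t : ℝ) : suspHeight a v t (some a) = t := by
  simp [suspHeight, hav]

theorem suspHeight_of_ne {a v i : ι} (hv : i ≠ v) (ha : i ≠ a) (t : ℝ) :
    suspHeight a v t (some i) = 0 := by
  simp [suspHeight, hv, ha]

theorem suspHeight_zero {a v i : ι} (hv : i ≠ v) : suspHeight a v 0 (some i) = 0 := by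
  simp [suspHeight, hv]

theorem continuous_suspPoint (p : ι → Esp d) (a v : ι) (o : Option ι) :
    Continuous fun t => suspPoint e p a v t o := by
  have : Continuous fun t => suspHeight a v t o := by
    rcases o with _ | i
    · exact continuous_const
    · simp only [suspHeight]
      split_ifs
      exacts [continuous_const, continuous_id, continuous_const]
  exact e.continuous.comp (continuous_const.prodMk this)

theorem suspDual_point (y : StrongDual ℝ (Esp d)) (s : ℝ) (p : ι → Esp d) (a v : ι) (t : ℝ)
    (o : Option ι) :
    suspDual e y s (suspPoint e p a v t o) = y (p (o.getD v)) + s * suspHeight a v t o :=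
  suspDual_apply ..

theorem suspProj_image (p : ι → Esp d) (a v : ι) (t : ℝ) (J : Set (Option ι)) :
    suspProj e '' (suspPoint e p a v t '' J) = p '' ((fun o => o.getD v) '' J) := by
  rw [Set.image_image, Set.image_image]
  exact Set.image_congr fun o _ => suspProj_apply ..

theorem getD_image_subset (v : ι) (J : Set (Option ι)) :
    (fun o : Option ι => o.getD v) '' J ⊆ insert v (suspCore v J) := by
  rintro _ ⟨_ | i, ho, rfl⟩
  · exact Set.mem_insert _ _
  · by_cases hi : i = v
    · exact Or.inl hi
    · exact Or.inr ⟨ho, fun h => absurd h hi⟩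

theorem getD_image_subset_core {v : ι} {J : Set (Option ι)} (hJ : none ∈ J ↔ some v ∈ J) :
    (fun o : Option ι => o.getD v) '' J ⊆ suspCore v J := by
  rintro _ ⟨_ | i, ho, rfl⟩
  · exact ⟨hJ.1 ho, fun _ => ho⟩
  · exact ⟨ho, fun (h : i = v) => hJ.2 (h ▸ ho)⟩

theorem polyDim_susp_le {p : ι → Esp d} {a v : ι} {t : ℝ} {J : Set (Option ι)}
    (h : (none ∈ J ↔ some v ∈ J) ∨ ∃ y s h, s ≠ 0 ∧
      ∀ o ∈ J, suspDual e y s (suspPoint e p a v t o) = h) :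
    polyDim (suspPoint e p a v t '' J) ≤ polyDim (p '' suspCore v J) + 1 := by
  rcases h with h | ⟨y, s, h, hs, hy⟩
  · refine (polyDim_le_polyDim_proj_add_one e _).trans (Nat.succ_le_succ (polyDim_mono ?_))
    rw [suspProj_image]
    exact Set.image_mono (getD_image_subset_core h)
  · refine (polyDim_le_polyDim_proj e hs (y := y) (h := h) ?_).trans ?_
    · rintro _ ⟨o, ho, rfl⟩
      exact hy o ho
    · rw [suspProj_image]
      refine (polyDim_mono (Set.image_mono (getD_image_subset v J))).trans ?_
      rw [Set.image_insert_eq]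
      exact polyDim_insert_le _ _

end Suspension

namespace Prismatoid

variable {d : ℕ} {ι : Type*} {Q : Prismatoid d} {p : ι → Esp d} {l : StrongDual ℝ (Esp d)}
  {m M : ℝ}

theorem IsRep.exists_strict_susp (hR : Q.IsRep p l m M) (e : (Esp d × ℝ) ≃L[ℝ] Esp (d + 1))
    {a v : ι} {t : ℝ} (ht0 : 0 ≤ t) (ht1 : t < 1) (o : Option ι) :
    ∃ z : StrongDual ℝ (Esp (d + 1)), ∀ o', o' ≠ o →
      z (suspPoint e p a v t o') < z (suspPoint e p a v t o) := by
  have hheight : ∀ i, i ≠ v → 0 ≤ suspHeight a v t (some i) ∧ suspHeight a v t (some i) < 1 := by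
    intro i hi
    by_cases hia : i = a
    · subst hia
      rw [suspHeight_lift hi]
      exact ⟨ht0, ht1⟩
    · rw [suspHeight_of_ne hi hia]
      exact ⟨le_rfl, one_pos⟩
  rcases o with _ | x
  · obtain ⟨y, hy⟩ := hR.strict v
    refine ⟨suspDual e y 1, fun o' ho' => ?_⟩
    rw [suspDual_point, suspDual_point]
    rcases o' with _ | i
    · exact absurd rfl ho'
    · rw [suspHeight_none]
      by_cases hi : i = v
      · subst hi
        rw [suspHeight_self]
        simp only [Option.getD_some, Option.getD_none]
        linarith
      · have h1 := hy i hi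
        have h2 := (hheight i hi).2
        simp only [Option.getD_some, Option.getD_none]
        linarith
  · by_cases hx : x = v
    · subst hx
      obtain ⟨y, hy⟩ := hR.strict x
      refine ⟨suspDual e y (-1), fun o' ho' => ?_⟩
      rw [suspDual_point, suspDual_point, suspHeight_self]
      rcases o' with _ | i
      · rw [suspHeight_none]
        simp only [Option.getD_some, Option.getD_none]
        linarith
      · have hi : i ≠ x := fun h => ho' (h ▸ rfl)
        have h1 := hy i hi
        have h2 := (hheight i hi).1
        simp only [Option.getD_some]
        linarith
    · obtain ⟨y, hy⟩ := hR.strict x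
      refine ⟨suspDual e y 0, fun o' ho' => ?_⟩
      rw [suspDual_point, suspDual_point, zero_mul, zero_mul, add_zero, add_zero]
      refine hy _ ?_
      rcases o' with _ | i
      · exact fun h => hx h.symm
      · exact fun h => ho' (congrArg some h)

/-- The dual distance grows under a perturbed one-point suspension, provided that the dual pyramid
condition `hpyr` holds at the vertex `a` that is pushed off the hyperplane. -/
theorem IsRep.exists_susp [Finite ι] (hR : Q.IsRep p l m M) (hd : 2 ≤ d) {a v : ι}
    (ha : l (p a) = M) (hv : l (p v) = m)
    (haff : p a ∈ affineSpan ℝ (p '' ({i | l (p i) = M} \ {a})))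
    (hpyr : ∀ F, IsFacet Q.P F → F ≠ Q.Qp → p a ∈ F →
      p a ∉ affineSpan ℝ (p '' ({i | p i ∈ F} \ {a}))) :
    ∃ Q' : Prismatoid (d + 1), Q'.nverts = Nat.card ι + 1 ∧ Q.width + 1 ≤ Q'.width := by
  have hav : a ≠ v := by
    rintro rfl
    exact hR.lt.ne (hv.symm.trans ha)
  have hl0 : l ≠ 0 := by
    rintro rfl
    exact hR.lt.ne (hv.symm.trans ha)
  let e : (Esp d × ℝ) ≃L[ℝ] Esp (d + 1) := ContinuousLinearEquiv.ofFinrankEq (by simp)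
  obtain ⟨t, ⟨hsupp, ht1⟩, ht0⟩ := ((((eventually_forall_supporting
    (continuous_suspPoint e p a v)).and (eventually_lt_nhds one_pos)).filter_mono
    nhdsWithin_le_nhds).and (self_mem_nhdsWithin (s := Set.Ioi (0 : ℝ)))).exists
  replace ht0 : 0 < t := ht0
  have hL : ∀ o, suspDual e l 0 (suspPoint e p a v t o) = l (p (o.getD v)) := fun o => by
    rw [suspDual_point, zero_mul, add_zero]
  have hconst : ∀ {S : Set ι} {k : ℝ}, d ≤ polyDim (p '' S) + 1 → (∀ i ∈ S, l (p i) = k) →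
      ∀ {y : StrongDual ℝ (Esp d)} {h : ℝ}, (∀ i ∈ S, y (p i) = h) → ∃ c : ℝ, y = c • l := by
    intro S k hS hk y h hy
    exact exists_smul_eq_of_const hS hl0 (by rintro _ ⟨i, hi, rfl⟩; exact hk i hi)
      (by rintro _ ⟨i, hi, rfl⟩; exact hy i hi)
  have hdimM : d + 1 ≤ polyDim (suspPoint e p a v t ''
      {o | suspDual e l 0 (suspPoint e p a v t o) = M}) + 1 := by
    refine le_polyDim_add_one_of_forall_const (suspDual e l 0) fun z h hz => ?_
    obtain ⟨y, s, rfl⟩ := exists_eq_suspDual e z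
    have hz' : ∀ o : Option ι, l (p (o.getD v)) = M → y (p (o.getD v)) +
        s * suspHeight a v t o = h := fun o ho => by
      rw [← suspDual_point]
      exact hz _ ⟨o, (hL o).trans ho, rfl⟩
    have hne : ∀ i, l (p i) = M → i ≠ v := by
      rintro i hi rfl
      exact hR.lt.ne (hv.symm.trans hi)
    have hA : ∀ i, l (p i) = M → i ≠ a → y (p i) = h := fun i hi hia => by
      simpa [suspHeight_of_ne (hne i hi) hia] using hz' (some i) hi
    have hya : y (p a) = h := eq_of_mem_affineSpan
      (by rintro _ ⟨i, hi, rfl⟩; exact hA i hi.1 hi.2) haff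
    have h1 := hz' (some a) ha
    rw [suspHeight_lift hav, Option.getD_some, hya] at h1
    have hs : s = 0 := (mul_eq_zero.1 (by linarith : s * t = 0)).resolve_right ht0.ne'
    obtain ⟨c, rfl⟩ := hconst hR.dim_top.ge (fun i hi => hi) (y := y) (h := h) fun i hi => by
      rcases eq_or_ne i a with rfl | hia
      · exact hya
      · exact hA i hi hia
    exact ⟨c, by rw [hs, suspDual_smul]⟩
  have hdimm : d + 1 ≤ polyDim (suspPoint e p a v t ''
      {o | suspDual e l 0 (suspPoint e p a v t o) = m}) + 1 := by
    refine le_polyDim_add_one_of_forall_const (suspDual e l 0) fun z h hz => ?_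
    obtain ⟨y, s, rfl⟩ := exists_eq_suspDual e z
    have hz' : ∀ o : Option ι, l (p (o.getD v)) = m → y (p (o.getD v)) +
        s * suspHeight a v t o = h := fun o ho => by
      rw [← suspDual_point]
      exact hz _ ⟨o, (hL o).trans ho, rfl⟩
    have h1 := hz' none hv
    have h2 := hz' (some v) hv
    rw [suspHeight_none] at h1
    rw [suspHeight_self] at h2
    simp only [Option.getD_some, Option.getD_none] at h1 h2
    have hs : s = 0 := by linarith
    subst hs
    obtain ⟨c, rfl⟩ := hconst hR.dim_bot.ge (fun i hi => hi) (y := y) (h := h) fun i hi => by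
      simpa using hz' (some i) hi
    exact ⟨c, suspDual_smul ..⟩
  obtain ⟨Q', hR'⟩ := exists_isRep_of_levels (by omega)
    (hR.exists_strict_susp e ht0.le ht1) hR.lt (fun o => by rw [hL]; exact hR.two _) hdimM hdimm
  set q := suspPoint e p a v t with hq
  let K : Set (Esp (d + 1)) → Set ι := fun F => suspCore v {o | q o ∈ F}
  have hcases : ∀ F, IsFacet Q'.P F → (q none ∈ F ↔ q (some v) ∈ F) ∨ ∃ y s h, s ≠ 0 ∧
      ∀ o, q o ∈ F → suspDual e y s (q o) = h := by
    intro F hF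
    obtain ⟨z, h, -, -, hiff⟩ := hR'.exists_contact hF
    obtain ⟨y, s, rfl⟩ := exists_eq_suspDual e z
    rcases eq_or_ne s 0 with rfl | hs
    · refine Or.inl ?_
      rw [hiff, hiff, suspDual_point, suspDual_point]
      simp
    · exact Or.inr ⟨y, s, h, hs, fun o ho => (hiff o).1 ho⟩
  have hdimK : ∀ F, IsFacet Q'.P F → d ≤ polyDim (p '' K F) + 1 := by
    intro F hF
    have h1 := hR'.dim_facet hF
    have h2 := polyDim_susp_le e (p := p) (a := a) (v := v) (t := t) (J := {o | q o ∈ F})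
      (hcases F hF)
    rw [← hq] at h2
    change polyDim (q '' {o | q o ∈ F}) ≤ polyDim (p '' K F) + 1 at h2
    omega
  have hex : ∀ F, IsFacet Q'.P F → ∃ G, IsFacet Q.P G ∧ p '' K F ⊆ G := by
    intro F hF
    obtain ⟨z, h, hz0, hle, hiff⟩ := hR'.exists_contact hF
    obtain ⟨w, hw0, hw⟩ := hsupp {o | q o ∈ F}
      ⟨z, hz0, fun j hj i => (hle i).trans_eq ((hiff j).1 hj).symm⟩
    obtain ⟨y, s, rfl⟩ := exists_eq_suspDual e w
    simp only [suspDual_point] at hw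
    have hnone : ∀ j, q j ∈ F → y (p v) + s ≤ y (p (j.getD v)) + s * suspHeight a v 0 j :=
      fun j hj => by simpa [suspHeight_none] using hw j hj none
    have hself : ∀ j, q j ∈ F → y (p v) - s ≤ y (p (j.getD v)) + s * suspHeight a v 0 j :=
      fun j hj => by simpa [suspHeight_self, sub_eq_add_neg] using hw j hj (some v)
    have hother : ∀ i, i ≠ v → ∀ j, q j ∈ F →
        y (p i) ≤ y (p (j.getD v)) + s * suspHeight a v 0 j :=
      fun i hi j hj => by simpa [suspHeight_zero hi] using hw j hj (some i)
    have hK : ∀ k ∈ K F, y (p v) + |s| ≤ y (p k) ∧ ∀ i, i ≠ v → y (p i) ≤ y (p k) := by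
      rintro k ⟨hk, hkv⟩
      replace hk : q (some k) ∈ F := hk
      rcases eq_or_ne k v with rfl | hne
      · have h1 := hnone _ hk
        have h2 := hself none (hkv rfl)
        rw [suspHeight_self] at h1
        rw [suspHeight_none] at h2
        simp only [Option.getD_some, Option.getD_none] at h1 h2
        have hs : s = 0 := by linarith
        subst hs
        refine ⟨by simp, fun i hi => ?_⟩
        simpa using hother i hi _ hk
      · have h1 := hnone _ hk
        have h2 := hself _ hk
        rw [suspHeight_zero hne] at h1 h2
        simp only [Option.getD_some] at h1 h2
        refine ⟨?_, fun i hi => ?_⟩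
        · rcases abs_cases s with ⟨hs, -⟩ | ⟨hs, -⟩ <;> linarith
        · simpa [suspHeight_zero hne] using hother i hi _ hk
    refine hR.exists_isFacet hd (y := y) ?_ (fun k hk i => ?_) (hdimK F hF)
    · rintro rfl
      obtain ⟨_, k, hk, rfl⟩ := nonempty_of_polyDim hd (hdimK F hF)
      have h1 := (hK k hk).1
      simp only [_root_.zero_apply, zero_add, abs_nonpos_iff] at h1
      subst h1
      refine hw0 ?_
      have := suspDual_smul e 0 (0 : StrongDual ℝ (Esp d))
      rwa [zero_smul, zero_smul] at this
    · rcases eq_or_ne i v with rfl | hi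
      · linarith [(hK k hk).1, abs_nonneg s]
      · exact (hK k hk).2 i hi
  choose φ hφ hφsub using hex
  let f : {F : Set (Esp (d + 1)) // IsFacet Q'.P F} → {F : Set (Esp d) // IsFacet Q.P F} :=
    fun F => ⟨φ F.1 F.2, hφ F.1 F.2⟩
  have hfp : f ⟨Q'.Qp, Q'.facetP⟩ = ⟨Q.Qp, Q.facetP⟩ := by
    refine Subtype.ext (hR.eq_of_subset hd (hφ _ _) Q.facetP (hdimK _ Q'.facetP) (hφsub _ _) ?_)
    rintro _ ⟨i, hi, rfl⟩
    exact (hR.mem_top_iff i).2 ((hL _).symm.trans ((hR'.mem_top_iff _).1 hi.1))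
  have hfm : f ⟨Q'.Qm, Q'.facetM⟩ = ⟨Q.Qm, Q.facetM⟩ := by
    refine Subtype.ext (hR.eq_of_subset hd (hφ _ _) Q.facetM (hdimK _ Q'.facetM) (hφsub _ _) ?_)
    rintro _ ⟨i, hi, rfl⟩
    exact (hR.mem_bot_iff i).2 ((hL _).symm.trans ((hR'.mem_bot_iff _).1 hi.1))
  have hadj : ∀ F G, (dualGraph Q'.P).Adj F G → f F = f G ∨ (dualGraph Q.P).Adj (f F) (f G) := by
    intro F G hFG
    have hKF : suspCore v {o | q o ∈ F.1 ∧ q o ∈ G.1} ⊆ K F.1 :=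
      fun i hi => ⟨hi.1.1, fun h => (hi.2 h).1⟩
    have hKG : suspCore v {o | q o ∈ F.1 ∧ q o ∈ G.1} ⊆ K G.1 :=
      fun i hi => ⟨hi.1.2, fun h => (hi.2 h).2⟩
    refine hR.eq_or_adj hd ((Set.image_mono hKF).trans (hφsub F.1 F.2))
      ((Set.image_mono hKG).trans (hφsub G.1 G.2)) ?_
    have h1 := hR'.dim_inter_of_adj hFG
    have h2 := polyDim_susp_le e (p := p) (a := a) (v := v) (t := t)
      (J := {o | q o ∈ F.1 ∧ q o ∈ G.1}) ?_
    · rw [← hq] at h2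
      omega
    · rcases hcases F.1 F.2 with hF | ⟨y, s, h, hs, hy⟩
      · rcases hcases G.1 G.2 with hG | ⟨y, s, h, hs, hy⟩
        · exact Or.inl (and_congr hF hG)
        · exact Or.inr ⟨y, s, h, hs, fun o ho => hy o ho.2⟩
      · exact Or.inr ⟨y, s, h, hs, fun o ho => hy o ho.1⟩
  have hfirst : ∀ F, (dualGraph Q'.P).Adj ⟨Q'.Qp, Q'.facetP⟩ F →
      f F = f ⟨Q'.Qp, Q'.facetP⟩ := by
    intro F hF
    by_contra hne
    rw [hfp] at hne
    have hne' : φ F.1 F.2 ≠ Q.Qp := fun h => hne (Subtype.ext h)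
    have hdim := hR'.dim_inter_of_adj hF
    set J : Set (Option ι) := {o | q o ∈ Q'.Qp ∧ q o ∈ F.1} with hJ
    have htop : ∀ o ∈ J, l (p (o.getD v)) = M := fun o ho =>
      (hL o).symm.trans ((hR'.mem_top_iff o).1 ho.1)
    have hnv : ∀ o ∈ J, o.getD v ≠ v := fun o ho h => by
      have := htop o ho
      rw [h, hv] at this
      exact hR.lt.ne this
    have hsub : (fun o : Option ι => o.getD v) '' J ⊆ {i | some i ∈ J} := by
      rintro _ ⟨_ | i, ho, rfl⟩
      · exact absurd rfl (hnv _ ho)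
      · exact ho
    have hcore : {i | some i ∈ J} ⊆ K F.1 := fun i hi =>
      ⟨hi.2, fun h => absurd h (hnv _ hi)⟩
    have hlow : ¬ d ≤ polyDim (p '' {i | some i ∈ J}) + 1 := fun h => by
      refine hne' (hR.eq_of_subset hd (hφ F.1 F.2) Q.facetP h
        ((Set.image_mono hcore).trans (hφsub F.1 F.2)) ?_)
      rintro _ ⟨i, hi, rfl⟩
      exact (hR.mem_top_iff i).2 (htop _ hi)
    have hflat : ∀ J' ⊆ J, some a ∉ J' →
        polyDim (q '' J') ≤ polyDim (p '' ((fun o : Option ι => o.getD v) '' J')) := by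
      intro J' hJ' haJ'
      rw [← suspProj_image e p a v t]
      refine polyDim_le_polyDim_proj e one_ne_zero (y := 0) (h := 0) ?_
      rintro _ ⟨_ | i, ho, rfl⟩
      · exact absurd rfl (hnv _ (hJ' ho))
      · have hiv : i ≠ v := hnv _ (hJ' ho)
        have hia : i ≠ a := by
          rintro rfl
          exact haJ' ho
        rw [suspDual_point, suspHeight_of_ne hiv hia]
        simp
    by_cases haJ : some a ∈ J
    · have h1 := hflat (J \ {some a}) Set.sdiff_subset fun h => h.2 rfl
      have h2 : (fun o : Option ι => o.getD v) '' (J \ {some a}) ⊆ {i | some i ∈ J} \ {a} := by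
        rintro _ ⟨o, ho, rfl⟩
        refine ⟨hsub ⟨o, ho.1, rfl⟩, fun h => ho.2 ?_⟩
        rcases o with _ | i
        · exact absurd rfl (hnv _ ho.1)
        · exact congrArg some h
      have h3 := polyDim_mono (Set.image_mono (f := p) h2)
      have h4 : polyDim (q '' J) ≤ polyDim (q '' (J \ {some a})) + 1 := by
        rw [image_eq_insert_image q haJ]
        exact polyDim_insert_le _ _
      rcases (p '' ({i | some i ∈ J} \ {a})).eq_empty_or_nonempty with hemp | hnonemp
      · have h5 : J \ {some a} = ∅ := by
          rw [Set.image_eq_empty] at hemp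
          rw [hemp, Set.subset_empty_iff, Set.image_eq_empty] at h2
          exact h2
        have h6 : q '' J = {q (some a)} := by
          rw [image_eq_insert_image q haJ, h5, Set.image_empty]
          simp
        rw [h6, polyDim_singleton] at hdim
        omega
      · have hsub' : {i | some i ∈ J} ⊆ {i | p i ∈ φ F.1 F.2} :=
          fun i hi => hφsub F.1 F.2 ⟨i, hcore hi, rfl⟩
        have h5 : p a ∉ affineSpan ℝ (p '' ({i | some i ∈ J} \ {a})) := fun h =>
          hpyr _ (hφ F.1 F.2) hne' (hφsub F.1 F.2 ⟨a, hcore haJ, rfl⟩)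
            (affineSpan_mono ℝ (Set.image_mono (Set.sdiff_subset_sdiff_left hsub')) h)
        have h6 := polyDim_lt_polyDim_insert hnonemp h5
        rw [← image_eq_insert_image p (J := {i | some i ∈ J}) haJ] at h6
        omega
    · have h1 := hflat J subset_rfl haJ
      have h2 := polyDim_mono (Set.image_mono (f := p) hsub)
      omega
  refine ⟨Q', ?_, ?_⟩
  · rw [hR'.nverts_eq, Finite.card_option]
  · have := SimpleGraph.dist_map_add_one_le hadj hfirst
      (fun h => Q'.ne (congrArg Subtype.val h))
      (hR'.reachable (by omega) ⟨Q'.Qp, Q'.facetP⟩ ⟨Q'.Qm, Q'.facetM⟩)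
    rwa [hfp, hfm] at this

end Prismatoid

namespace Prismatoid

theorem ncard_le_polyDim_add_one {d : ℕ} {ι : Type*} {p : ι → Esp d} {A : Set ι} (hA : A.Finite)
    (h : ∀ a ∈ A, p a ∉ affineSpan ℝ (p '' (A \ {a}))) : A.ncard ≤ polyDim (p '' A) + 1 := by
  induction A, hA using Set.Finite.induction_on with
  | empty => simp
  | @insert a A ha hA ih =>
    have hih := ih fun b hb hmem => h b (Set.mem_insert_of_mem a hb)
      (affineSpan_mono ℝ (Set.image_mono
        (Set.sdiff_subset_sdiff_left (Set.subset_insert a A))) hmem)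
    rw [Set.ncard_insert_of_notMem ha hA]
    rcases A.eq_empty_or_nonempty with rfl | hne
    · simp
    · have h1 := h a (Set.mem_insert a A)
      rw [Set.insert_sdiff_self_of_notMem ha] at h1
      have h2 := polyDim_lt_polyDim_insert (hne.image p) h1
      rw [← Set.image_insert_eq] at h2
      omega

theorem two_le_of_lt_width {d : ℕ} (Q : Prismatoid d) (h : d < Q.width) : 2 ≤ d := by
  have hwalk : ∀ F G, (dualGraph Q.P).Walk F G → F ≠ G → 2 ≤ d := by
    intro F G w hne
    cases w with
    | nil => exact absurd rfl hne
    | cons hadj _ =>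
      have h1 := hadj.2
      have h2 := Q.dimP
      omega
  have hreach : (dualGraph Q.P).Reachable ⟨Q.Qp, Q.facetP⟩ ⟨Q.Qm, Q.facetM⟩ := by
    by_contra hn
    rw [width, SimpleGraph.dist_eq_zero_of_not_reachable hn] at h
    omega
  exact hreach.elim fun w => hwalk _ _ w fun h => Q.ne (congrArg Subtype.val h)

theorem IsRep.exists_lift {d : ℕ} {ι : Type*} [Finite ι] {Q : Prismatoid d} {p : ι → Esp d}
    {l : StrongDual ℝ (Esp d)} {m M : ℝ} (hR : Q.IsRep p l m M) (hd : 2 ≤ d)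
    (hcard : d < {i | l (p i) = M}.ncard) :
    ∃ Q' : Prismatoid (d + 1), Q'.nverts = Nat.card ι + 1 ∧ Q.width + 1 ≤ Q'.width := by
  obtain ⟨a, ha, haff⟩ : ∃ a ∈ {i | l (p i) = M},
      p a ∈ affineSpan ℝ (p '' ({i | l (p i) = M} \ {a})) := by
    by_contra! hind
    have h1 := ncard_le_polyDim_add_one (Set.toFinite _) hind
    rw [hR.dim_top] at h1
    omega
  obtain ⟨Q₁, p₁, hR₁, ha₁, haff₁, hwidth, hpyr⟩ := hR.exists_pull hd ha haff
  obtain ⟨_, v, hv, rfl⟩ := nonempty_of_polyDim hd hR₁.dim_bot.ge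
  obtain ⟨Q₂, hn, hw⟩ := hR₁.exists_susp hd ha₁ hv haff₁ hpyr
  exact ⟨Q₂, hn, by omega⟩

theorem IsRep.exists_succ {d : ℕ} {ι : Type*} [Finite ι] {Q : Prismatoid d} {p : ι → Esp d}
    {l : StrongDual ℝ (Esp d)} {m M : ℝ} (hR : Q.IsRep p l m M) (hd : 2 ≤ d)
    (hcard : 2 * d < Nat.card ι) :
    ∃ Q' : Prismatoid (d + 1), Q'.nverts = Nat.card ι + 1 ∧ Q.width + 1 ≤ Q'.width := by
  rcases lt_or_ge d {i | l (p i) = M}.ncard with h | h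
  · exact hR.exists_lift hd h
  · rw [← Q.swap_width]
    refine hR.swap.exists_lift hd ?_
    have h1 : {i | l (p i) = M} ∪ {i | l (p i) = m} = Set.univ :=
      Set.eq_univ_of_forall fun i => (hR.two i).symm
    have h2 := Set.ncard_union_le {i | l (p i) = M} {i | l (p i) = m}
    rw [h1, Set.ncard_univ] at h2
    simp only [_root_.neg_apply, neg_inj]
    omega

end Prismatoid

end

/-- For any `d`-prismatoid `Q` with `n > 2d` vertices and width `l > d`, there
is a `(d+1)`-prismatoid with `n + 1` vertices and width at least `l + 1`
(obtained by a one-point suspension at a vertex of a base facet followed by a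
suitable small perturbation). -/
theorem stmt9 (d n l : ℕ) (Q : Prismatoid d) (hn : Q.nverts = n) (hl : Q.width = l)
    (h1 : 2 * d < n) (h2 : d < l) :
    ∃ Q' : Prismatoid (d + 1), Q'.nverts = n + 1 ∧ l + 1 ≤ Q'.width := by
  subst hn hl
  obtain ⟨φ, m, M, hR⟩ := Q.exists_isRep
  have := Q.poly.finite_extremePoints.to_subtype
  rw [hR.nverts_eq] at h1 ⊢
  exact hR.exists_succ (Q.two_le_of_lt_width h2) h1
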